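/- arXiv:1712.04156 — 3 statements merged into one kernel-verified Lean document; each statement's English description precedes it below -/
import Mathlib

section
/- Let (X,dx) and (Y,dy) be measure spaces, 0<p,q<∞, and α=min(p,q). Let (f_n) be a sequence of measurable functions on X×Y with sup_n ∫_X(∫_Y |f_n|^q dy)^{p/q} dx < ∞, and suppose f_n = π_n + ρ_n + σ_n where: |π_n| ≤ Π pointwise for some Π with ‖Π‖_{L^p_xL^q_y} < ∞, ρ_n → 0 almost everywhere on X×Y, and ‖σ_n‖_{L^p_xL^q_y} → 0. Then ‖f_n‖_{L^p_xL^q_y}^α ≤ ‖π_n‖_{L^p_xL^q_y}^α + ‖ρ_n‖_{L^p_xL^q_y}^α + o(1) as n→∞. -/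
open MeasureTheory Filter
open scoped ENNReal Topology

noncomputable section

/-- Mixed norm `‖f‖_{L^p_x L^q_y} = (∫_X (∫_Y |f(x,y)|^q dν)^{p/q} dμ)^{1/p}`,
valued in `ℝ≥0∞`. -/
def mixedNormM {X Y : Type*} [MeasurableSpace X] [MeasurableSpace Y]
    (μ : Measure X) (ν : Measure Y) (p q : ℝ) (f : X → Y → ℂ) : ℝ≥0∞ :=
  (∫⁻ x, (∫⁻ y, (‖f x y‖₊ : ℝ≥0∞) ^ q ∂ν) ^ (p / q) ∂μ) ^ (1 / p)

end

noncomputable section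


/-- Mixed norm of an `ℝ≥0∞`-valued function on the product. -/
def mixE {X Y : Type*} [MeasurableSpace X] [MeasurableSpace Y]
    (μ : Measure X) (ν : Measure Y) (p q : ℝ) (F : X × Y → ℝ≥0∞) : ℝ≥0∞ :=
  (∫⁻ x, (∫⁻ y, F (x, y) ^ q ∂ν) ^ (p / q) ∂μ) ^ (1 / p)

section helpers

variable {X Y : Type*} [MeasurableSpace X] [MeasurableSpace Y]
    (μ : Measure X) (ν : Measure Y) [SigmaFinite μ] [SigmaFinite ν]
    {p q : ℝ}

theorem mixE_mono (hp : 0 < p) (hq : 0 < q) {F G : X × Y → ℝ≥0∞} (h : ∀ z, F z ≤ G z) :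
    mixE μ ν p q F ≤ mixE μ ν p q G := by
  unfold mixE
  gcongr with x y
  exact h _

theorem mixE_meas {F : X × Y → ℝ≥0∞} (hF : Measurable F) (r : ℝ) :
    Measurable (fun x => (∫⁻ y, F (x, y) ^ q ∂ν) ^ r) := by
  exact (Measurable.lintegral_prod_right' (f := fun z => F z ^ q) (hF.pow_const q)).pow_const r

theorem mixE_add (hp : 0 < p) (hq : 0 < q) {b : ℝ} (hb : 0 < b) (hb1 : b ≤ 1) (hbp : b ≤ p)
    (hbq : b ≤ q) {F G : X × Y → ℝ≥0∞} (hF : Measurable F) (hG : Measurable G) :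
    mixE μ ν p q (fun z => F z + G z) ^ b ≤ mixE μ ν p q F ^ b + mixE μ ν p q G ^ b := by
  have key : ∀ H : X × Y → ℝ≥0∞, mixE μ ν p q H ^ b =
      (∫⁻ x, ((∫⁻ y, (H (x, y) ^ b) ^ (q / b) ∂ν) ^ (1 / (q / b))) ^ (p / b) ∂μ)
        ^ (1 / (p / b)) := by
    intro H
    unfold mixE
    simp only [← ENNReal.rpow_mul]
    congr 1
    · congr 1
      ext x
      congr 1
      · congr 1
        ext y
        congr 1
        field_simp
      · field_simp
    · field_simp
  rw [key, key, key]
  have h1 : 1 ≤ q / b := by rwa [le_div_iff₀ hb, one_mul]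
  have h2 : 1 ≤ p / b := by rwa [le_div_iff₀ hb, one_mul]
  have hm : ∀ {H : X × Y → ℝ≥0∞}, Measurable H →
      Measurable (fun x => (∫⁻ y, (H (x, y) ^ b) ^ (q / b) ∂ν) ^ (1 / (q / b))) := fun hH =>
    mixE_meas ν (F := fun z => _) (hH.pow_const b) _
  refine le_trans ?_ (ENNReal.lintegral_Lp_add_le (hm hF).aemeasurable (hm hG).aemeasurable h2)
  gcongr with x
  simp only [Pi.add_apply]
  refine le_trans ?_ (ENNReal.lintegral_Lp_add_le
    (f := fun y => F (x, y) ^ b) (g := fun y => G (x, y) ^ b)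
    ((hF.comp measurable_prodMk_left).pow_const b).aemeasurable
    ((hG.comp measurable_prodMk_left).pow_const b).aemeasurable h1)
  gcongr with y
  exact ENNReal.rpow_add_le_add_rpow _ _ hb.le hb1

theorem mixE_disj (hp : 0 < p) (hq : 0 < q) {F G : X × Y → ℝ≥0∞} (hF : Measurable F)
    (hG : Measurable G) (h : ∀ z, F z = 0 ∨ G z = 0) :
    mixE μ ν p q (fun z => F z + G z) ^ min p q
      ≤ mixE μ ν p q F ^ min p q + mixE μ ν p q G ^ min p q := by
  have e : ∀ x, ∫⁻ y, (F (x, y) + G (x, y)) ^ q ∂ν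
      = ∫⁻ y, F (x, y) ^ q ∂ν + ∫⁻ y, G (x, y) ^ q ∂ν := by
    intro x
    have hm : Measurable fun y => F (x, y) ^ q := (hF.comp measurable_prodMk_left).pow_const q
    rw [← lintegral_add_left hm]
    congr 1
    ext y
    rcases h (x, y) with h | h <;> simp [h, ENNReal.zero_rpow_of_pos hq]
  unfold mixE
  simp only [e]
  rcases le_total p q with hpq | hpq
  · rw [min_eq_left hpq]
    simp only [← ENNReal.rpow_mul, one_div_mul_cancel hp.ne', ENNReal.rpow_one]
    rw [← lintegral_add_left (mixE_meas ν hF _)]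
    gcongr with x
    exact ENNReal.rpow_add_le_add_rpow _ _ (by positivity) (by rwa [div_le_one hq])
  · rw [min_eq_right hpq]
    have h2 : 1 ≤ p / q := by rwa [le_div_iff₀ hq, one_mul]
    have hm : ∀ {H : X × Y → ℝ≥0∞}, Measurable H →
      AEMeasurable (fun x => (∫⁻ y, H (x, y) ^ q ∂ν)) μ := fun hH => by
        simpa using (mixE_meas ν hH (q := q) 1).aemeasurable
    have := ENNReal.lintegral_Lp_add_le (hm hF) (hm hG) h2
    simp only [← ENNReal.rpow_mul]
    have e2 : 1 / p * q = 1 / (p / q) := by field_simp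
    rw [e2]
    exact this

theorem mixE_const (hp : 0 < p) (hq : 0 < q) {c : ℝ≥0∞} (hc : c ≠ ⊤) (F : X × Y → ℝ≥0∞) :
    mixE μ ν p q (fun z => c * F z) = c * mixE μ ν p q F := by
  unfold mixE
  simp only [ENNReal.mul_rpow_of_nonneg _ _ hq.le]
  have h1 : c ^ q ≠ ⊤ := ENNReal.rpow_ne_top_of_nonneg hq.le hc
  simp only [lintegral_const_mul' _ _ h1]
  simp only [ENNReal.mul_rpow_of_nonneg _ _ (div_pos hp hq).le]
  rw [lintegral_const_mul' _ _ (ENNReal.rpow_ne_top_of_nonneg (div_pos hp hq).le h1),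
    ENNReal.mul_rpow_of_nonneg _ _ (one_div_pos.2 hp).le]
  congr 1
  rw [← ENNReal.rpow_mul, ← ENNReal.rpow_mul]
  have : q * (p / q) * (1 / p) = 1 := by field_simp
  rw [← mul_assoc] at *
  rw [this, ENNReal.rpow_one]

theorem mixE_dct (hp : 0 < p) (hq : 0 < q) {F : ℕ → X × Y → ℝ≥0∞} {P : X × Y → ℝ≥0∞}
    (hF : ∀ n, Measurable (F n)) (hP : Measurable P) (hle : ∀ n z, F n z ≤ P z)
    (hfin : mixE μ ν p q P < ⊤)
    (hlim : ∀ᵐ z ∂(μ.prod ν), Tendsto (fun n => F n z) atTop (𝓝 0)) :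
    Tendsto (fun n => mixE μ ν p q (F n)) atTop (𝓝 0) := by
  have hpq := div_pos hp hq
  have hfin' : ∫⁻ x, (∫⁻ y, P (x, y) ^ q ∂ν) ^ (p / q) ∂μ ≠ ⊤ := by
    intro h
    unfold mixE at hfin
    rw [h, ENNReal.top_rpow_of_pos (one_div_pos.2 hp)] at hfin
    exact lt_irrefl _ hfin
  have z : ∀ {r : ℝ}, 0 < r → ∀ {u : ℕ → ℝ≥0∞}, Tendsto u atTop (𝓝 0) →
      Tendsto (fun n => u n ^ r) atTop (𝓝 0) := by
    intro r hr u hu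
    have := (ENNReal.continuous_rpow_const (y := r)).tendsto 0 |>.comp hu
    simpa [ENNReal.zero_rpow_of_pos hr, Function.comp_def] using this
  refine z (one_div_pos.2 hp) ?_
  have h0 : ∫⁻ _ : X, (0 : ℝ≥0∞) ∂μ = 0 := by simp
  rw [← h0]
  refine tendsto_lintegral_of_dominated_convergence
    (fun x => (∫⁻ y, P (x, y) ^ q ∂ν) ^ (p / q)) (fun n => mixE_meas ν (hF n) _) ?_ hfin' ?_
  · intro n
    refine Eventually.of_forall fun x => ?_
    dsimp only
    gcongr with y
    exact hle _ _
  · filter_upwards [Measure.ae_ae_of_ae_prod hlim, ae_lt_top (mixE_meas ν hP _) hfin'] with x hx hx2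
    refine z hpq ?_
    have h0 : ∫⁻ _ : Y, (0 : ℝ≥0∞) ∂ν = 0 := by simp
    rw [← h0]
    refine tendsto_lintegral_of_dominated_convergence (fun y => P (x, y) ^ q)
      (fun n => ((hF n).comp measurable_prodMk_left).pow_const q) ?_ ?_ ?_
    · intro n
      refine Eventually.of_forall fun y => ?_
      dsimp only
      gcongr
      exact hle _ _
    · intro h
      rw [h, ENNReal.top_rpow_of_pos hpq] at hx2
      exact lt_irrefl _ hx2
    · filter_upwards [hx] with y hy
      exact z hq hy

end helpers

/-- Uniform continuity of `t ↦ t ^ r` on bounded sets, in the form needed. -/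
theorem unif_rpow {M : ℝ≥0∞} (hM : M < ⊤) {r : ℝ} (hr : 0 < r) {ε : ℝ} (hε : 0 < ε) :
    ∃ κ : ℝ≥0∞, 0 < κ ∧ ∀ t s u : ℝ≥0∞, t ≤ M → t ≤ s + u → u ≤ κ →
      t ^ r ≤ s ^ r + ENNReal.ofReal ε := by
  have huc : UniformContinuousOn (fun x : ℝ => x ^ r) (Set.Icc 0 M.toReal) :=
    isCompact_Icc.uniformContinuousOn_of_continuous
      (Real.continuous_rpow_const hr.le).continuousOn
  rw [Metric.uniformContinuousOn_iff] at huc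
  obtain ⟨d, hd, H⟩ := huc ε hε
  refine ⟨ENNReal.ofReal (d / 2), by simpa using hd, ?_⟩
  intro t s u htM hts hu
  rcases le_total t s with h | h
  · exact (ENNReal.rpow_le_rpow h hr.le).trans le_self_add
  have htt : t ≠ ⊤ := (htM.trans_lt hM).ne
  have hst : s ≠ ⊤ := (h.trans_lt (lt_top_iff_ne_top.2 htt)).ne
  have h1 : t ≤ s + ENNReal.ofReal (d / 2) := hts.trans (by gcongr)
  lift t to NNReal using htt
  lift s to NNReal using hst
  have hM' : (t : ℝ) ≤ M.toReal := by
    simpa using ENNReal.toReal_mono hM.ne htM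
  have h2 : (t : ℝ) ≤ s + d / 2 := by
    have := ENNReal.toReal_mono (by simp) h1
    rw [ENNReal.toReal_add (by simp) (by simp), ENNReal.toReal_ofReal (by positivity)] at this
    simpa using this
  have h3 : (s : ℝ) ≤ t := by exact_mod_cast h
  have h4 := H t ⟨t.2, hM'⟩ s ⟨s.2, h3.trans hM'⟩ (by
    rw [Real.dist_eq, abs_lt]; constructor <;> linarith)
  rw [Real.dist_eq, abs_lt] at h4
  have h5 : (t : ℝ) ^ r ≤ (s : ℝ) ^ r + ε := by linarith [h4.2]
  have h6 := ENNReal.ofReal_le_ofReal h5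
  rw [ENNReal.ofReal_add (by positivity) hε.le, ← ENNReal.ofReal_rpow_of_nonneg t.coe_nonneg hr.le,
    ← ENNReal.ofReal_rpow_of_nonneg s.coe_nonneg hr.le] at h6
  simpa using h6

/-- generalized Brézis–Lieb lemma in mixed Lebesgue spaces. -/
theorem generalized_brezis_lieb {X Y : Type*} [MeasurableSpace X] [MeasurableSpace Y]
    (μ : Measure X) (ν : Measure Y) [SigmaFinite μ] [SigmaFinite ν]
    (p q : ℝ) (hp : 0 < p) (hq : 0 < q)
    (f pn rn sn : ℕ → X → Y → ℂ) (Pi0 : X → Y → ℝ)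
    (hfm : ∀ n, Measurable (Function.uncurry (f n)))
    (hpnm : ∀ n, Measurable (Function.uncurry (pn n)))
    (hrnm : ∀ n, Measurable (Function.uncurry (rn n)))
    (hsnm : ∀ n, Measurable (Function.uncurry (sn n)))
    (hPim : Measurable (Function.uncurry Pi0))
    (hbound : ∃ B : ℝ≥0∞, B < ⊤ ∧ ∀ n,
      (∫⁻ x, (∫⁻ y, (‖f n x y‖₊ : ℝ≥0∞) ^ q ∂ν) ^ (p / q) ∂μ) ≤ B)
    (hsplit : ∀ n x y, f n x y = pn n x y + rn n x y + sn n x y)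
    (hdom : ∀ n x y, ‖pn n x y‖ ≤ Pi0 x y)
    (hPi : mixedNormM μ ν p q (fun x y => (Pi0 x y : ℂ)) < ⊤)
    (hr : ∀ᵐ z ∂(μ.prod ν), Tendsto (fun n => rn n z.1 z.2) atTop (𝓝 0))
    (hs : Tendsto (fun n => mixedNormM μ ν p q (sn n)) atTop (𝓝 0)) :
    ∀ ε : ℝ, 0 < ε → ∃ N : ℕ, ∀ n ≥ N,
      mixedNormM μ ν p q (f n) ^ min p q ≤
        mixedNormM μ ν p q (pn n) ^ min p q + mixedNormM μ ν p q (rn n) ^ min p q +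
          ENNReal.ofReal ε := by
  intro ε hε
  classical
  obtain ⟨B, hB, hfB⟩ := hbound
  set b : ℝ := min 1 (min p q) with hbdef
  have hb : 0 < b := by simp [hbdef, hp, hq]
  have hb1 : b ≤ 1 := min_le_left _ _
  have hba : b ≤ min p q := min_le_right _ _
  have hbp : b ≤ p := hba.trans (min_le_left _ _)
  have hbq : b ≤ q := hba.trans (min_le_right _ _)
  have ha : 0 < min p q := lt_min hp hq
  have hM : (B ^ (1 / p)) ^ b < ⊤ :=
    ENNReal.rpow_lt_top_of_nonneg hb.le
      (ENNReal.rpow_ne_top_of_nonneg (one_div_pos.2 hp).le hB.ne)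
  obtain ⟨κ, hκ, hK⟩ := unif_rpow hM (div_pos ha hb) hε
  have conv : ∀ g : X → Y → ℂ, mixedNormM μ ν p q g = mixE μ ν p q (fun z => ‖g z.1 z.2‖ₑ) :=
    fun g => rfl
  have ralpha : ∀ t : ℝ≥0∞, (t ^ b) ^ (min p q / b) = t ^ min p q := by
    intro t
    rw [← ENNReal.rpow_mul]
    congr 1
    field_simp
  set P : X × Y → ℝ≥0∞ := fun z => ‖(Pi0 z.1 z.2 : ℂ)‖ₑ with hPdef
  have hPm : Measurable P := (Complex.measurable_ofReal.comp hPim).enorm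
  have hPfin : mixE μ ν p q P < ⊤ := hPi
  have hπP : ∀ n z, ‖pn n z.1 z.2‖ₑ ≤ P z := by
    intro n z
    apply enorm_le_iff_norm_le.2
    rw [Complex.norm_real]
    exact (hdom n z.1 z.2).trans (le_abs_self _)
  have hpm : ∀ n, Measurable fun z : X × Y => ‖pn n z.1 z.2‖ₑ := fun n => (hpnm n).enorm
  have hrm : ∀ n, Measurable fun z : X × Y => ‖rn n z.1 z.2‖ₑ := fun n => (hrnm n).enorm
  have hsm : ∀ n, Measurable fun z : X × Y => ‖sn n z.1 z.2‖ₑ := fun n => (hsnm n).enorm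
  have zlim : ∀ {r : ℝ}, 0 < r → ∀ {u : ℕ → ℝ≥0∞}, Tendsto u atTop (𝓝 0) →
      Tendsto (fun n => u n ^ r) atTop (𝓝 0) := by
    intro r hr u hu
    have := (ENNReal.continuous_rpow_const (y := r)).tendsto 0 |>.comp hu
    simpa [ENNReal.zero_rpow_of_pos hr, Function.comp_def] using this
  have hκ3 : 0 < κ / 3 := ENNReal.div_pos hκ.ne' (by simp)
  -- choose the threshold
  obtain ⟨δ, hδ0, hδt, hδ⟩ : ∃ δ : ℝ≥0∞, 0 < δ ∧ δ ≠ ⊤ ∧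
      (δ * mixE μ ν p q P) ^ b ≤ κ / 3 := by
    have hu : Tendsto (fun n : ℕ => ((n : ℝ≥0∞)⁻¹ * mixE μ ν p q P)) atTop (𝓝 0) := by
      have := ENNReal.Tendsto.mul_const (b := mixE μ ν p q P)
        ENNReal.tendsto_inv_nat_nhds_zero (Or.inr hPfin.ne)
      simpa using this
    obtain ⟨n, hn, hn1⟩ := (((zlim hb hu).eventually (gt_mem_nhds hκ3)).and
      (eventually_ge_atTop 1)).exists
    refine ⟨(n : ℝ≥0∞)⁻¹, by simp, ?_, hn.le⟩
    simp; omega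
  let E : ℕ → Set (X × Y) := fun n => {z | ‖rn n z.1 z.2‖ₑ ≤ δ * P z}
  have hE : ∀ n, MeasurableSet (E n) := fun n => measurableSet_le (hrm n) (hPm.const_mul δ)
  let A : ℕ → X × Y → ℝ≥0∞ := fun n => (E n).indicator fun z => ‖pn n z.1 z.2‖ₑ
  let R : ℕ → X × Y → ℝ≥0∞ := fun n => (E n)ᶜ.indicator fun z => ‖rn n z.1 z.2‖ₑ
  let Q : ℕ → X × Y → ℝ≥0∞ := fun n => (E n)ᶜ.indicator P
  have hAm : ∀ n, Measurable (A n) := fun n => (hpm n).indicator (hE n)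
  have hRm : ∀ n, Measurable (R n) := fun n => (hrm n).indicator (hE n).compl
  have hQm : ∀ n, Measurable (Q n) := fun n => hPm.indicator (hE n).compl
  have hQlim : Tendsto (fun n => mixE μ ν p q (Q n)) atTop (𝓝 0) := by
    refine mixE_dct μ ν hp hq hQm hPm (fun n z => Set.indicator_le_self _ _ _) hPfin ?_
    filter_upwards [hr] with z hz
    by_cases hPz : P z = 0
    · have : ∀ n, Q n z = 0 := fun n => by simp [Q, Set.indicator, hPz]
      simp [this]
    · have h1 : Tendsto (fun n => ‖rn n z.1 z.2‖ₑ) atTop (𝓝 0) := by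
        simpa [Function.comp_def] using (continuous_enorm.tendsto (0 : ℂ)).comp hz
      have h2 : 0 < δ * P z := ENNReal.mul_pos hδ0.ne' hPz
      refine tendsto_const_nhds.congr' ?_
      filter_upwards [h1.eventually (gt_mem_nhds h2)] with n hn
      have : z ∈ E n := hn.le
      simp [Q, this]
  have hS : Tendsto (fun n => mixE μ ν p q (fun z => ‖sn n z.1 z.2‖ₑ)) atTop (𝓝 0) := hs
  obtain ⟨N, hN⟩ := eventually_atTop.1
    (((zlim hb hQlim).eventually (gt_mem_nhds hκ3)).and
      ((zlim hb hS).eventually (gt_mem_nhds hκ3)))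
  refine ⟨N, fun n hn => ?_⟩
  obtain ⟨hQn, hSn⟩ := hN n hn
  have hAR : mixE μ ν p q (fun z => A n z + R n z) ^ min p q ≤
      mixedNormM μ ν p q (pn n) ^ min p q + mixedNormM μ ν p q (rn n) ^ min p q := by
    refine (mixE_disj μ ν hp hq (hAm n) (hRm n) ?_).trans ?_
    · intro z
      by_cases hz : z ∈ E n
      · right; simp [R, hz]
      · left; simp [A, hz]
    · rw [conv, conv]
      exact add_le_add
        (ENNReal.rpow_le_rpow (mixE_mono μ ν hp hq fun z => Set.indicator_le_self _ _ _) ha.le)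
        (ENNReal.rpow_le_rpow (mixE_mono μ ν hp hq fun z => Set.indicator_le_self _ _ _) ha.le)
  have hT : mixE μ ν p q (fun z => (δ * P z + Q n z) + ‖sn n z.1 z.2‖ₑ) ^ b ≤ κ := by
    refine (mixE_add μ ν hp hq hb hb1 hbp hbq ((hPm.const_mul δ).add (hQm n)) (hsm n)).trans ?_
    have h1 := mixE_add μ ν hp hq hb hb1 hbp hbq (hPm.const_mul δ) (hQm n)
    rw [mixE_const μ ν hp hq hδt] at h1
    calc _ ≤ (κ / 3 + κ / 3) + κ / 3 :=
          add_le_add (h1.trans (add_le_add hδ hQn.le)) hSn.le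
      _ = κ := ENNReal.add_thirds κ
  have hmain : mixedNormM μ ν p q (f n) ^ b ≤ mixE μ ν p q (fun z => A n z + R n z) ^ b +
      mixE μ ν p q (fun z => (δ * P z + Q n z) + ‖sn n z.1 z.2‖ₑ) ^ b := by
    refine le_trans ?_ (mixE_add μ ν hp hq hb hb1 hbp hbq ((hAm n).add (hRm n))
      (((hPm.const_mul δ).add (hQm n)).add (hsm n)))
    rw [conv]
    refine ENNReal.rpow_le_rpow (mixE_mono μ ν hp hq fun z => ?_) hb.le
    rw [hsplit]
    refine (enorm_add_le _ _).trans ?_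
    refine (add_le_add_left (enorm_add_le _ _) _).trans ?_
    rw [← add_assoc]
    refine add_le_add_left ?_ _
    by_cases hz : z ∈ E n
    · have : ‖rn n z.1 z.2‖ₑ ≤ δ * P z := hz
      simp only [A, R, Q, Set.indicator_of_mem hz, Set.mem_compl_iff, hz, not_true_eq_false,
        not_false_eq_true, Set.indicator_of_notMem, add_zero]
      gcongr
    · have hz' : z ∈ (E n)ᶜ := hz
      simp only [A, R, Q, Set.indicator_of_mem hz', hz,
        not_false_eq_true, Set.indicator_of_notMem, zero_add]
      rw [add_comm]
      exact add_le_add le_rfl ((hπP n z).trans le_add_self)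
  have hfb : mixedNormM μ ν p q (f n) ^ b ≤ (B ^ (1 / p)) ^ b :=
    ENNReal.rpow_le_rpow (ENNReal.rpow_le_rpow (hfB n) (one_div_pos.2 hp).le) hb.le
  have := hK _ _ _ hfb hmain hT
  rw [ralpha, ralpha] at this
  exact this.trans (by gcongr)

end
end

section
/- Let r>0, M,N ≥ 1, and let ψ: ℝ^M×ℝ^N×𝕋^M×𝕋^N → [0,∞) (where 𝕋^k = (ℝ/2πℤ)^k) satisfy: (1) there is a null set E ⊂ ℝ^M×ℝ^N such that for all (x₁,x₂)∉E, the map (θ₁,θ₂) ↦ ψ(x₁,x₂,θ₁,θ₂) is continuous on 𝕋^M×𝕋^N; (2) for all (θ₁,θ₂), the map (x₁,x₂) ↦ ψ(x₁,x₂,θ₁,θ₂) is measurable; (3) ∫_{ℝ^M} (∫_{ℝ^N} sup_{(θ₁,θ₂)} ψ(x₁,x₂,θ₁,θ₂) dx₂)^r dx₁ < ∞. Then lim_{ε→0} ∫_{ℝ^M} (∫_{ℝ^N} ψ(x₁,x₂, x₁/ε², x₂/ε) dx₂)^r dx₁ = ∫_{𝕋^M}∫_{ℝ^M} (∫_{𝕋^N}∫_{ℝ^N}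 ψ(x₁,x₂,θ₁,θ₂) dx₂ dθ₂)^r dx₁ dθ₁, where dθ denotes normalized Haar measure on the torus and x/ε is understood modulo 2πℤ componentwise. -/
open MeasureTheory Filter
open scoped ENNReal Topology

noncomputable section

instance : Fact ((0:ℝ) < 2 * Real.pi) := ⟨by positivity⟩

/-- The torus `𝕋 = ℝ/2πℤ`. -/
abbrev Tor := AddCircle (2 * Real.pi)

lemma hm_translate {n : ℕ} {E : Type*} [NormedAddCommGroup E] (g : (Fin n → ℝ) → E)
    (hg : Integrable g) :
    Tendsto (fun s : Fin n → ℝ => ∫ x, ‖g (x + s) - g x‖) (𝓝 0) (𝓝 0) := by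
  have hp : ∀ s : Fin n → ℝ, MeasurePreserving (fun x : Fin n → ℝ => x + s) volume volume :=
    fun s => measurePreserving_add_right volume s
  let T : (Fin n → ℝ) → C((Fin n → ℝ), (Fin n → ℝ)) := fun s => ⟨fun x => x + s, by fun_prop⟩
  have hT : Continuous T := by
    apply ContinuousMap.continuous_of_continuous_uncurry
    change Continuous (fun p : (Fin n → ℝ) × (Fin n → ℝ) => p.2 + p.1)
    fun_prop
  have hc : Continuous (fun s => Lp.compMeasurePreserving (T s) (hp s) (hg.toL1 g)) :=
    Continuous.compMeasurePreservingLp continuous_const hT hp (by simp)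
  have h2 := (hc.tendsto 0).dist (tendsto_const_nhds (x := hg.toL1 g))
  have h0 : Lp.compMeasurePreserving (T 0) (hp 0) (hg.toL1 g) = hg.toL1 g := by
    rw [Integrable.toL1, Lp.toLp_compMeasurePreserving]
    congr 1
    ext x
    simp [T]
  rw [h0, dist_self] at h2
  refine h2.congr fun s => ?_
  rw [Integrable.toL1, Lp.toLp_compMeasurePreserving]
  have hgs : Integrable (g ∘ fun x => x + s) := hg.comp_add_right s
  have : dist (hgs.toL1 _) (hg.toL1 g) = ∫ x, ‖g (x + s) - g x‖ := by
    rw [dist_eq_norm, ← Integrable.toL1_sub, L1.norm_of_fun_eq_integral_norm]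
    rfl
  exact this

lemma hm_measurable {X K : Type*} [MeasurableSpace X] [TopologicalSpace K] [CompactSpace K]
    [T2Space K] [SecondCountableTopology K] (Ψ : X → C(K, ℝ))
    (h : ∀ θ, Measurable (fun x => Ψ x θ)) : StronglyMeasurable Ψ := by
  borelize C(K, ℝ)
  rcases isEmpty_or_nonempty K with hK | hK
  · have : Subsingleton C(K, ℝ) := ⟨fun a b => by ext x; exact hK.elim x⟩
    exact stronglyMeasurable_const' fun x y => Subsingleton.elim _ _
  let e : C(K, ℝ) → (ℕ → ℝ) := fun f n => f (TopologicalSpace.denseSeq K n)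
  have he : Continuous e := continuous_pi fun n => by dsimp [e]; fun_prop
  have hi : Function.Injective e := by
    intro f g hfg
    apply DFunLike.coe_injective
    apply Continuous.ext_on (TopologicalSpace.denseRange_denseSeq K) f.continuous g.continuous
    rintro _ ⟨n, rfl⟩
    exact congrFun hfg n
  have hm := he.measurableEmbedding hi
  have : Measurable Ψ := by
    rw [← hm.measurable_comp_iff]
    exact measurable_pi_iff.2 fun n => h _
  exact this.stronglyMeasurable

/-- projection to the torus -/
def hmPi {n : ℕ} (x : Fin n → ℝ) : Fin n → Tor := fun i => ((x i : ℝ) : Tor)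

lemma hmPi_cont {n : ℕ} : Continuous (hmPi (n := n)) := by
  unfold hmPi
  exact continuous_pi fun i => (AddCircle.continuous_mk' _).comp (continuous_apply i)

lemma hmPi_add {n : ℕ} (x y : Fin n → ℝ) : hmPi (x + y) = hmPi x + hmPi y := by
  ext i; simp [hmPi]

lemma hmPi_lift {n : ℕ} (θ : Fin n → Tor) : ∃ t : Fin n → ℝ, hmPi t = θ ∧ ‖t‖ ≤ 2 * Real.pi := by
  have : ∀ i, ∃ t : ℝ, (t : Tor) = θ i ∧ |t| ≤ 2 * Real.pi := by
    intro i
    refine ⟨AddCircle.equivIco (2 * Real.pi) 0 (θ i), AddCircle.coe_equivIco, ?_⟩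
    have := (AddCircle.equivIco (2 * Real.pi) 0 (θ i)).2
    rw [Set.mem_Ico] at this
    rw [abs_le]; constructor <;> linarith [Real.pi_pos]
  choose t h1 h2 using this
  refine ⟨t, funext h1, ?_⟩
  rw [pi_norm_le_iff_of_nonneg (by positivity)]
  exact h2

/-- normalized Haar measure -/
def hmMu (n : ℕ) : Measure (Fin n → Tor) := ((ENNReal.ofReal (2 * Real.pi))⁻¹ ^ n) • volume

instance (n : ℕ) : IsProbabilityMeasure (hmMu n) := by
  constructor
  have : (volume : Measure (Fin n → Tor)) Set.univ = (ENNReal.ofReal (2 * Real.pi)) ^ n := by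
    rw [← Set.pi_univ, volume_pi_pi]
    simp [AddCircle.measure_univ]
  simp only [hmMu, Measure.smul_apply, smul_eq_mul, this]
  rw [← mul_pow, ENNReal.inv_mul_cancel, one_pow]
  · simp [Real.pi_pos]
  · exact ENNReal.ofReal_ne_top

instance (n : ℕ) : (hmMu n).IsAddLeftInvariant := by
  unfold hmMu; infer_instance

lemma hm_basic {n : ℕ} {P : Type*} [TopologicalSpace P] [CompactSpace P]
    (g : (Fin n → ℝ) → C(P × (Fin n → Tor), ℝ)) (hg : Integrable g) {δ : ℝ} (hδ : 0 < δ) :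
    ∀ᶠ ε in 𝓝[>] (0:ℝ), ∀ p : P,
      |(∫ x, g x (p, hmPi (ε⁻¹ • x))) - ∫ θ, (∫ x, g x) (p, θ) ∂(hmMu n)| ≤ δ := by
  have ht := hm_translate g hg
  rw [Metric.tendsto_nhds_nhds] at ht
  obtain ⟨η, hη, hs⟩ := ht δ hδ
  have hev : ∀ᶠ ε in 𝓝[>] (0:ℝ), ε < η / (2 * Real.pi) :=
    (eventually_lt_nhds (by positivity)).filter_mono nhdsWithin_le_nhds
  filter_upwards [hev, self_mem_nhdsWithin] with ε h1 h2 p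
  have hε : 0 < ε := h2
  -- measurability and integrability facts
  have hev : Continuous (fun q : C(P × (Fin n → Tor), ℝ) × (Fin n → Tor) => q.1 (p, q.2)) := by
    fun_prop
  have hintg : ∀ (s : Fin n → ℝ) (f : (Fin n → ℝ) → (Fin n → Tor)), Continuous f →
      Integrable (fun x => g (x + s) (p, f x)) := by
    intro s f hf
    have hgs : Integrable (fun x => g (x + s)) := hg.comp_add_right s
    refine hgs.norm.mono' ?_ (ae_of_all _ fun x => ContinuousMap.norm_coe_le_norm _ _)
    exact hev.comp_aestronglyMeasurable
      (hgs.aestronglyMeasurable.prodMk hf.aestronglyMeasurable)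
  have hsc : Continuous (fun x : Fin n → ℝ => hmPi (ε⁻¹ • x)) :=
    hmPi_cont.comp (continuous_const_smul _)
  have key : ∀ θ : Fin n → Tor,
      ‖(∫ x, g x (p, hmPi (ε⁻¹ • x))) - ∫ x, g x (p, hmPi (ε⁻¹ • x) + θ)‖ ≤ δ := by
    intro θ
    obtain ⟨t, rfl, htn⟩ := hmPi_lift θ
    have e1 : (∫ x, g x (p, hmPi (ε⁻¹ • x))) =
        ∫ x, g (x + ε • t) (p, hmPi (ε⁻¹ • x) + hmPi t) := by
      rw [← integral_add_right_eq_self _ (ε • t)]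
      refine integral_congr_ae (ae_of_all _ fun x => ?_)
      simp only [smul_add, smul_smul, inv_mul_cancel₀ hε.ne', one_smul, hmPi_add]
    have i0 := hintg 0 (fun x => hmPi (ε⁻¹ • x) + hmPi t) (hsc.add continuous_const)
    simp only [add_zero] at i0
    have i1 := hintg (ε • t) (fun x => hmPi (ε⁻¹ • x) + hmPi t) (hsc.add continuous_const)
    rw [e1, ← integral_sub i1 i0]
    refine (norm_integral_le_integral_norm _).trans ?_
    have hd : dist (ε • t) 0 < η := by
      rw [dist_zero_right, norm_smul, Real.norm_of_nonneg hε.le]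
      calc ε * ‖t‖ ≤ ε * (2 * Real.pi) := by gcongr
        _ < η := by rwa [lt_div_iff₀ (by positivity)] at h1
    have h3 := hs hd
    rw [dist_zero_right, Real.norm_eq_abs] at h3
    refine le_trans ?_ ((le_abs_self _).trans h3.le)
    refine integral_mono_of_nonneg (ae_of_all _ fun _ => norm_nonneg _)
      ((hg.comp_add_right _).sub hg).norm (ae_of_all _ fun x => ?_)
    exact ContinuousMap.norm_coe_le_norm (g (x + ε • t) - g x) _
  -- product integrability
  have hprod : Integrable (fun z : (Fin n → Tor) × (Fin n → ℝ) => g z.2 (p, hmPi (ε⁻¹ • z.2) + z.1))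
      ((hmMu n).prod volume) := by
    refine (hg.norm.comp_snd (hmMu n)).mono' ?_
      (ae_of_all _ fun x => ContinuousMap.norm_coe_le_norm _ _)
    refine hev.comp_aestronglyMeasurable
      (hg.aestronglyMeasurable.comp_snd.prodMk (Continuous.aestronglyMeasurable ?_))
    exact (hsc.comp continuous_snd).add continuous_fst
  have hprod' : Integrable (fun z : (Fin n → Tor) × (Fin n → ℝ) => g z.2 (p, z.1))
      ((hmMu n).prod volume) := by
    refine (hg.norm.comp_snd (hmMu n)).mono' ?_
      (ae_of_all _ fun x => ContinuousMap.norm_coe_le_norm _ _)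
    exact hev.comp_aestronglyMeasurable
      (hg.aestronglyMeasurable.comp_snd.prodMk continuous_fst.aestronglyMeasurable)
  have e2 : ∫ θ, (∫ x, g x) (p, θ) ∂(hmMu n) =
      ∫ θ, (∫ x, g x (p, hmPi (ε⁻¹ • x) + θ)) ∂(hmMu n) := by
    have : ∀ θ, (∫ x, g x) (p, θ) = ∫ x, g x (p, θ) := fun θ => ContinuousMap.integral_apply hg _
    simp_rw [this]
    have s1 := integral_integral_swap (f := fun θ x => g x (p, θ)) hprod'
    have s2 := integral_integral_swap (f := fun θ x => g x (p, hmPi (ε⁻¹ • x) + θ)) hprod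
    rw [s1, s2]
    refine integral_congr_ae (ae_of_all _ fun x => ?_)
    exact (integral_add_left_eq_self (fun θ => g x (p, θ)) _).symm
  have e3 : (∫ x, g x (p, hmPi (ε⁻¹ • x))) - ∫ θ, (∫ x, g x) (p, θ) ∂(hmMu n) =
      ∫ θ, ((∫ x, g x (p, hmPi (ε⁻¹ • x))) - ∫ x, g x (p, hmPi (ε⁻¹ • x) + θ)) ∂(hmMu n) := by
    rw [e2, integral_sub (integrable_const _) hprod.integral_prod_left]
    simp
  rw [e3, ← Real.norm_eq_abs]
  refine (norm_integral_le_of_norm_le_const (ae_of_all _ key)).trans ?_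
  simp

lemma hm_rpow {l : Filter ℝ} {r S : ℝ} (hr : 0 < r) {a b : ℝ → ℝ}
    (ha : ∀ x, a x ∈ Set.Icc 0 S) (hb : ∀ x, b x ∈ Set.Icc 0 S)
    (h : ∀ δ > 0, ∀ᶠ x in l, |a x - b x| ≤ δ) :
    Tendsto (fun x => a x ^ r - b x ^ r) l (𝓝 0) := by
  have hu : UniformContinuousOn (fun x : ℝ => x ^ r) (Set.Icc 0 S) :=
    isCompact_Icc.uniformContinuousOn_of_continuous
      (Real.continuous_rpow_const hr.le).continuousOn
  rw [Metric.uniformContinuousOn_iff] at hu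
  rw [Metric.tendsto_nhds]
  intro δ hδ
  obtain ⟨η, hη, hu⟩ := hu δ hδ
  filter_upwards [h (η / 2) (by positivity)] with x hx
  have := hu (a x) (ha x) (b x) (hb x) (by rw [Real.dist_eq]; linarith)
  rw [dist_zero_right, Real.norm_eq_abs]
  rwa [Real.dist_eq] at this

theorem homogenization_mixed (r : ℝ) (hr : 0 < r) (M N : ℕ) (hM : 1 ≤ M) (hN : 1 ≤ N)
    (ψ : (Fin M → ℝ) → (Fin N → ℝ) → (Fin M → Tor) → (Fin N → Tor) → ℝ)
    (hpos : ∀ x₁ x₂ θ₁ θ₂, 0 ≤ ψ x₁ x₂ θ₁ θ₂)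
    (hE : ∃ E : Set ((Fin M → ℝ) × (Fin N → ℝ)),
      volume E = 0 ∧ ∀ z ∉ E,
        Continuous (fun θ : (Fin M → Tor) × (Fin N → Tor) => ψ z.1 z.2 θ.1 θ.2))
    (hmeas : ∀ θ₁ θ₂,
      Measurable (fun z : (Fin M → ℝ) × (Fin N → ℝ) => ψ z.1 z.2 θ₁ θ₂))
    (hint : (∫⁻ x₁ : Fin M → ℝ,
        (∫⁻ x₂ : Fin N → ℝ, ⨆ θ₁, ⨆ θ₂, ENNReal.ofReal (ψ x₁ x₂ θ₁ θ₂)) ^ r) < ⊤) :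
    Tendsto (fun ε : ℝ => ∫⁻ x₁ : Fin M → ℝ,
        (∫⁻ x₂ : Fin N → ℝ, ENNReal.ofReal
            (ψ x₁ x₂ (fun i => ((x₁ i / ε ^ 2 : ℝ) : Tor))
              (fun j => ((x₂ j / ε : ℝ) : Tor)))) ^ r)
      (𝓝[>] (0:ℝ))
      (𝓝 ((ENNReal.ofReal (2 * Real.pi))⁻¹ ^ M *
        ∫⁻ θ₁ : Fin M → Tor, ∫⁻ x₁ : Fin M → ℝ,
          ((ENNReal.ofReal (2 * Real.pi))⁻¹ ^ N *
            ∫⁻ θ₂ : Fin N → Tor, ∫⁻ x₂ : Fin N → ℝ,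
              ENNReal.ofReal (ψ x₁ x₂ θ₁ θ₂)) ^ r)) := by
  classical
  obtain ⟨E, hE0, hEc⟩ := hE
  let E' := toMeasurable volume E
  have hE'0 : volume E' = 0 := by rw [measure_toMeasurable, hE0]
  have hE'm : MeasurableSet E' := measurableSet_toMeasurable _ _
  have hEc' : ∀ z, z ∉ E' →
      Continuous (fun θ : (Fin M → Tor) × (Fin N → Tor) => ψ z.1 z.2 θ.1 θ.2) :=
    fun z hz => hEc z fun h => hz (subset_toMeasurable _ _ h)
  let Ψ : (Fin M → ℝ) × (Fin N → ℝ) → C((Fin M → Tor) × (Fin N → Tor), ℝ) := fun z =>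
    if h : z ∉ E' then ⟨fun θ => ψ z.1 z.2 θ.1 θ.2, hEc' z h⟩ else 0
  have hΨ1 : ∀ z, z ∉ E' → ∀ θ, Ψ z θ = ψ z.1 z.2 θ.1 θ.2 := by
    intro z hz θ
    simp only [Ψ, dif_pos hz]; rfl
  have hΨ2 : ∀ z, z ∈ E' → ∀ θ, Ψ z θ = 0 := by
    intro z hz θ
    simp [Ψ, hz]
  have hΨpos : ∀ z θ, 0 ≤ Ψ z θ := by
    intro z θ
    by_cases hz : z ∈ E'
    · rw [hΨ2 z hz]
    · rw [hΨ1 z hz]; exact hpos _ _ _ _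
  have hΨm : StronglyMeasurable Ψ := by
    apply hm_measurable
    intro θ
    have : (fun x => Ψ x θ) = E'ᶜ.indicator (fun z => ψ z.1 z.2 θ.1 θ.2) := by
      ext z
      by_cases hz : z ∈ E'
      · simp [hz, hΨ2 z hz]
      · simp [hz, hΨ1 z hz]
    rw [this]
    exact (hmeas θ.1 θ.2).indicator hE'm.compl
  have hae : ∀ᵐ x₁ : Fin M → ℝ, ∀ᵐ x₂ : Fin N → ℝ, ∀ θ, Ψ (x₁, x₂) θ = ψ x₁ x₂ θ.1 θ.2 := by
    have h1 : ∀ᵐ z : (Fin M → ℝ) × (Fin N → ℝ), z ∉ E' := measure_eq_zero_iff_ae_notMem.1 hE'0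
    rw [Measure.volume_eq_prod] at h1
    filter_upwards [Measure.ae_ae_of_ae_prod h1] with x₁ hx
    filter_upwards [hx] with x₂ hx2 θ
    exact hΨ1 _ hx2 θ
  let S : (Fin M → ℝ) → ℝ≥0∞ := fun x₁ => ∫⁻ x₂, ‖Ψ (x₁, x₂)‖ₑ
  have hSm : Measurable S := hΨm.enorm.lintegral_prod_right'
  have hSint : ∫⁻ x₁, S x₁ ^ r ≠ ⊤ := by
    refine (lt_of_le_of_lt ?_ hint).ne
    refine lintegral_mono_ae ?_
    filter_upwards [hae] with x₁ hx
    refine ENNReal.rpow_le_rpow ?_ hr.le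
    refine lintegral_mono_ae ?_
    filter_upwards [hx] with x₂ hx2
    obtain ⟨θ, hθ⟩ : ∃ θ, ‖Ψ (x₁, x₂)‖ = ‖Ψ (x₁, x₂) θ‖ := by
      obtain ⟨θ, -, hθ⟩ := isCompact_univ.exists_isMaxOn Set.univ_nonempty
        ((Ψ (x₁, x₂)).continuous.norm.continuousOn)
      refine ⟨θ, le_antisymm ?_ (ContinuousMap.norm_coe_le_norm _ _)⟩
      rw [ContinuousMap.norm_le _ (norm_nonneg _)]
      exact fun y => hθ (Set.mem_univ y)
    rw [← ofReal_norm, hθ, Real.norm_of_nonneg (hΨpos _ _), hx2]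
    exact le_iSup₂ (f := fun a b => ENNReal.ofReal (ψ x₁ x₂ a b)) θ.1 θ.2
  have hgood : ∀ᵐ x₁ : Fin M → ℝ, Integrable (fun x₂ => Ψ (x₁, x₂)) := by
    filter_upwards [ae_lt_top (hSm.pow_const r) hSint] with x₁ hx
    refine ⟨(hΨm.comp_measurable measurable_prodMk_left).aestronglyMeasurable, ?_⟩
    exact (ENNReal.rpow_lt_top_iff_of_pos hr).1 hx
  have hsint : Integrable (fun x₁ => (S x₁).toReal ^ r) := by
    have := integrable_toReal_of_lintegral_ne_top (hSm.pow_const r).aemeasurable hSint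
    simpa only [ENNReal.toReal_rpow] using this
  have hSr : ∀ x₁, Integrable (fun x₂ => Ψ (x₁, x₂)) → ∫ x₂, ‖Ψ (x₁, x₂)‖ = (S x₁).toReal := by
    intro x₁ hx
    rw [integral_norm_eq_lintegral_enorm hx.aestronglyMeasurable]
  -- evaluation
  have hevm : ∀ (f : (Fin M → ℝ) × (Fin N → ℝ) → (Fin M → Tor) × (Fin N → Tor)), Continuous f →
      StronglyMeasurable (fun z => Ψ z (f z)) := by
    intro f hf
    have hc : Continuous (fun q : C((Fin M → Tor) × (Fin N → Tor), ℝ) ×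
        ((Fin M → Tor) × (Fin N → Tor)) => q.1 q.2) := by fun_prop
    exact hc.comp_stronglyMeasurable (hΨm.prodMk hf.stronglyMeasurable)
  have hevi : ∀ x₁, Integrable (fun x₂ => Ψ (x₁, x₂)) →
      ∀ (f : (Fin N → ℝ) → (Fin M → Tor) × (Fin N → Tor)), Continuous f →
      Integrable (fun x₂ => Ψ (x₁, x₂) (f x₂)) := by
    intro x₁ hx f hf
    refine hx.norm.mono' ?_ (ae_of_all _ fun x => ContinuousMap.norm_coe_le_norm _ _)
    exact ((hevm (fun z => f z.2) (hf.comp continuous_snd)).comp_measurable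
      measurable_prodMk_left).aestronglyMeasurable
  let a : ℝ → (Fin M → ℝ) → ℝ := fun ε x₁ =>
    ∫ x₂, Ψ (x₁, x₂) (hmPi ((ε ^ 2)⁻¹ • x₁), hmPi (ε⁻¹ • x₂))
  let I : (Fin M → ℝ) → C((Fin M → Tor) × (Fin N → Tor), ℝ) := fun x₁ => ∫ x₂, Ψ (x₁, x₂)
  let b : (Fin M → ℝ) → (Fin M → Tor) → ℝ := fun x₁ θ₁ => ∫ θ₂, I x₁ (θ₁, θ₂) ∂(hmMu N)
  have hsc : ∀ (k : ℕ) (c : ℝ), Continuous (fun x : Fin k → ℝ => hmPi (c • x)) := fun k c =>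
    hmPi_cont.comp (continuous_const_smul _)
  have hIm : StronglyMeasurable I := hΨm.integral_prod_right'
  have hIpos : ∀ x₁ θ, 0 ≤ I x₁ θ := by
    intro x₁ θ
    by_cases hx : Integrable (fun x₂ => Ψ (x₁, x₂))
    · simp only [I]
      rw [ContinuousMap.integral_apply hx]
      exact integral_nonneg fun x₂ => hΨpos _ _
    · simp only [I]
      rw [integral_undef hx]; simp
  have hInorm : ∀ x₁, Integrable (fun x₂ => Ψ (x₁, x₂)) → ‖I x₁‖ ≤ (S x₁).toReal := by
    intro x₁ hx
    rw [← hSr x₁ hx]; exact norm_integral_le_integral_norm _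
  have hIi : ∀ x₁ θ₁, Integrable (fun θ₂ => I x₁ (θ₁, θ₂)) (hmMu N) := by
    intro x₁ θ₁
    refine (integrable_const ‖I x₁‖).mono' (Continuous.aestronglyMeasurable (by fun_prop))
      (ae_of_all _ fun x => ContinuousMap.norm_coe_le_norm _ _)
  have ham : ∀ ε, StronglyMeasurable (a ε) := by
    intro ε
    refine StronglyMeasurable.integral_prod_right' (f := fun z : (Fin M → ℝ) × (Fin N → ℝ) =>
      Ψ z (hmPi ((ε ^ 2)⁻¹ • z.1), hmPi (ε⁻¹ • z.2))) (hevm _ ?_)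
    exact ((hsc M _).comp continuous_fst).prodMk ((hsc N _).comp continuous_snd)
  have hapos : ∀ ε x₁, 0 ≤ a ε x₁ := fun ε x₁ => integral_nonneg fun x₂ => hΨpos _ _
  have hbpos : ∀ x₁ θ₁, 0 ≤ b x₁ θ₁ := fun x₁ θ₁ => integral_nonneg fun x₂ => hIpos _ _
  have hale : ∀ x₁, Integrable (fun x₂ => Ψ (x₁, x₂)) → ∀ ε, a ε x₁ ≤ (S x₁).toReal := by
    intro x₁ hx ε
    rw [← hSr x₁ hx]
    refine integral_mono_of_nonneg (ae_of_all _ fun _ => hΨpos _ _) hx.norm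
      (ae_of_all _ fun x₂ => ?_)
    exact (Real.le_norm_self _).trans (ContinuousMap.norm_coe_le_norm _ _)
  have hble : ∀ x₁, Integrable (fun x₂ => Ψ (x₁, x₂)) → ∀ θ₁, b x₁ θ₁ ≤ (S x₁).toReal := by
    intro x₁ hx θ₁
    refine le_trans ?_ (hInorm x₁ hx)
    have : b x₁ θ₁ ≤ ∫ θ₂, ‖I x₁‖ ∂(hmMu N) := by
      refine integral_mono_of_nonneg (ae_of_all _ fun _ => hIpos _ _) (integrable_const _)
        (ae_of_all _ fun x₂ => ?_)
      exact (Real.le_norm_self _).trans (ContinuousMap.norm_coe_le_norm _ _)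
    simpa using this
  have hbc : ∀ x₁, Continuous (b x₁) := by
    intro x₁
    refine continuous_of_dominated (bound := fun _ => ‖I x₁‖)
      (fun θ₁ => Continuous.aestronglyMeasurable (by fun_prop))
      (fun θ₁ => ae_of_all _ fun θ₂ => ContinuousMap.norm_coe_le_norm _ _)
      (integrable_const _) (ae_of_all _ fun θ₂ => by fun_prop)
  have hbm : StronglyMeasurable (fun q : (Fin M → ℝ) × (Fin M → Tor) => b q.1 q.2) := by
    have hc : Continuous (fun q : C((Fin M → Tor) × (Fin N → Tor), ℝ) ×
        ((Fin M → Tor) × (Fin N → Tor)) => q.1 q.2) := by fun_prop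
    refine StronglyMeasurable.integral_prod_right'
      (f := fun z : ((Fin M → ℝ) × (Fin M → Tor)) × (Fin N → Tor) => I z.1.1 (z.1.2, z.2)) ?_
    refine hc.comp_stronglyMeasurable ((hIm.comp_measurable (by fun_prop)).prodMk
      (Measurable.stronglyMeasurable (by fun_prop)))
  have hpc : Continuous (fun x : ℝ => x ^ r) := Real.continuous_rpow_const hr.le
  let G : (Fin M → ℝ) → C(Unit × (Fin M → Tor), ℝ) := fun x₁ =>
    ⟨fun q => b x₁ q.2 ^ r, hpc.comp ((hbc x₁).comp continuous_snd)⟩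
  have hGm : StronglyMeasurable G := by
    apply hm_measurable
    intro q
    exact (hpc.comp_stronglyMeasurable
      (hbm.comp_measurable (measurable_prodMk_right (y := q.2)))).measurable
  have hGi : Integrable G := by
    refine hsint.mono' hGm.aestronglyMeasurable ?_
    filter_upwards [hgood] with x₁ hx
    rw [ContinuousMap.norm_le _ (by positivity)]
    intro q
    change ‖b x₁ q.2 ^ r‖ ≤ _
    rw [Real.norm_of_nonneg (Real.rpow_nonneg (hbpos _ _) _)]
    exact Real.rpow_le_rpow (hbpos _ _) (hble x₁ hx _) hr.le
  -- the two limits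
  let L : ℝ := ∫ θ, (∫ x₁, G x₁) ((), θ) ∂(hmMu M)
  have hlim2 : Tendsto (fun ε : ℝ => ∫ x₁, b x₁ (hmPi ((ε ^ 2)⁻¹ • x₁)) ^ r) (𝓝[>] 0) (𝓝 L) := by
    have hsq : Tendsto (fun ε : ℝ => ε ^ 2) (𝓝[>] 0) (𝓝[>] 0) := by
      rw [tendsto_nhdsWithin_iff]
      constructor
      · have : Tendsto (fun ε : ℝ => ε ^ 2) (𝓝 0) (𝓝 0) := by
          simpa using (continuous_pow 2 (M := ℝ)).tendsto 0
        exact this.mono_left nhdsWithin_le_nhds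
      · filter_upwards [self_mem_nhdsWithin] with ε hε
        exact pow_pos (Set.mem_Ioi.1 hε) 2
    rw [Metric.tendsto_nhds]
    intro δ hδ
    filter_upwards [hsq.eventually (hm_basic G hGi (half_pos hδ))] with ε hε
    have := hε ()
    rw [Real.dist_eq]
    exact lt_of_le_of_lt this (half_lt_self hδ)
  have hai : ∀ ε, Integrable (fun x₁ => a ε x₁ ^ r) := by
    intro ε
    refine hsint.mono' (hpc.comp_stronglyMeasurable (ham ε)).aestronglyMeasurable ?_
    filter_upwards [hgood] with x₁ hx
    rw [Real.norm_of_nonneg (Real.rpow_nonneg (hapos _ _) _)]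
    exact Real.rpow_le_rpow (hapos _ _) (hale x₁ hx _) hr.le
  have hbi : ∀ f : (Fin M → ℝ) → (Fin M → Tor), Continuous f →
      Integrable (fun x₁ => b x₁ (f x₁) ^ r) := by
    intro f hf
    refine hsint.mono' (hpc.comp_stronglyMeasurable (hbm.comp_measurable
      (measurable_id.prodMk hf.measurable))).aestronglyMeasurable ?_
    filter_upwards [hgood] with x₁ hx
    rw [Real.norm_of_nonneg (Real.rpow_nonneg (hbpos _ _) _)]
    exact Real.rpow_le_rpow (hbpos _ _) (hble x₁ hx _) hr.le
  have hlim1 : Tendsto (fun ε : ℝ => ∫ x₁, (a ε x₁ ^ r - b x₁ (hmPi ((ε ^ 2)⁻¹ • x₁)) ^ r))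
      (𝓝[>] 0) (𝓝 0) := by
    have := tendsto_integral_filter_of_dominated_convergence (μ := volume) (l := 𝓝[>] (0:ℝ))
      (F := fun ε x₁ => a ε x₁ ^ r - b x₁ (hmPi ((ε ^ 2)⁻¹ • x₁)) ^ r) (f := fun _ => 0)
      (fun x₁ => (S x₁).toReal ^ r) ?_ ?_ hsint ?_
    · simpa using this
    · exact Eventually.of_forall fun ε => ((hai ε).sub (hbi _ (hsc M _))).aestronglyMeasurable
    · refine Eventually.of_forall fun ε => ?_
      filter_upwards [hgood] with x₁ hx
      rw [Real.norm_eq_abs]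
      have h1 := Real.rpow_nonneg (hapos ε x₁) r
      have h2 := Real.rpow_nonneg (hbpos x₁ (hmPi ((ε ^ 2)⁻¹ • x₁))) r
      have h3 := Real.rpow_le_rpow (hapos ε x₁) (hale x₁ hx _) hr.le
      have h4 := Real.rpow_le_rpow (hbpos _ (hmPi ((ε ^ 2)⁻¹ • x₁))) (hble x₁ hx _) hr.le
      rw [abs_le]; constructor <;> linarith
    · filter_upwards [hgood] with x₁ hx
      refine hm_rpow (S := (S x₁).toReal) hr (fun ε => ⟨hapos _ _, hale x₁ hx _⟩)
        (fun ε => ⟨hbpos _ _, hble x₁ hx _⟩) fun δ hδ => ?_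
      filter_upwards [hm_basic (fun x₂ => Ψ (x₁, x₂)) hx hδ] with ε hε
      exact hε _
  have hlim : Tendsto (fun ε : ℝ => ∫ x₁, a ε x₁ ^ r) (𝓝[>] 0) (𝓝 L) := by
    have := hlim1.add hlim2
    rw [zero_add] at this
    refine this.congr fun ε => ?_
    rw [integral_sub (hai ε) (hbi _ (hsc M _))]
    exact sub_add_cancel _ _
  -- identification of both sides
  have hpi : ∀ (k : ℕ) (c : ℝ) (x : Fin k → ℝ),
      (fun i => ((x i / c : ℝ) : Tor)) = hmPi (c⁻¹ • x) := by
    intro k c x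
    ext i
    simp [hmPi, div_eq_inv_mul]
  have hL : ∀ ε : ℝ, ∫⁻ x₁ : Fin M → ℝ,
        (∫⁻ x₂ : Fin N → ℝ, ENNReal.ofReal
            (ψ x₁ x₂ (fun i => ((x₁ i / ε ^ 2 : ℝ) : Tor))
              (fun j => ((x₂ j / ε : ℝ) : Tor)))) ^ r
      = ENNReal.ofReal (∫ x₁, a ε x₁ ^ r) := by
    intro ε
    rw [ofReal_integral_eq_lintegral_ofReal (hai ε)
      (ae_of_all _ fun x₁ => Real.rpow_nonneg (hapos _ _) _)]
    refine lintegral_congr_ae ?_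
    filter_upwards [hgood, hae] with x₁ hx hx'
    rw [← ENNReal.ofReal_rpow_of_nonneg (hapos _ _) hr.le]
    congr 1
    simp only [a]
    rw [ofReal_integral_eq_lintegral_ofReal
      (hevi x₁ hx (fun x₂ => (hmPi ((ε ^ 2)⁻¹ • x₁), hmPi (ε⁻¹ • x₂)))
        (continuous_const.prodMk (hsc N _)))
      (ae_of_all _ fun x₂ => hΨpos _ _)]
    refine lintegral_congr_ae ?_
    filter_upwards [hx'] with x₂ hx2
    rw [hx2, hpi, hpi]
  have hinner : ∀ x₁, Integrable (fun x₂ => Ψ (x₁, x₂)) →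
      (∀ᵐ x₂ : Fin N → ℝ, ∀ θ, Ψ (x₁, x₂) θ = ψ x₁ x₂ θ.1 θ.2) → ∀ θ₁,
      (ENNReal.ofReal (2 * Real.pi))⁻¹ ^ N *
            ∫⁻ θ₂ : Fin N → Tor, ∫⁻ x₂ : Fin N → ℝ,
              ENNReal.ofReal (ψ x₁ x₂ θ₁ θ₂) = ENNReal.ofReal (b x₁ θ₁) := by
    intro x₁ hx hx' θ₁
    simp only [b]
    rw [ofReal_integral_eq_lintegral_ofReal (hIi x₁ θ₁) (ae_of_all _ fun θ₂ => hIpos _ _)]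
    rw [hmMu, lintegral_smul_measure, smul_eq_mul]
    congr 1
    refine lintegral_congr fun θ₂ => ?_
    simp only [I]
    rw [ContinuousMap.integral_apply hx, ofReal_integral_eq_lintegral_ofReal
      (hevi x₁ hx _ continuous_const) (ae_of_all _ fun x₂ => hΨpos _ _)]
    refine lintegral_congr_ae ?_
    filter_upwards [hx'] with x₂ hx2
    rw [hx2]
  have hR : ((ENNReal.ofReal (2 * Real.pi))⁻¹ ^ M *
        ∫⁻ θ₁ : Fin M → Tor, ∫⁻ x₁ : Fin M → ℝ,
          ((ENNReal.ofReal (2 * Real.pi))⁻¹ ^ N *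
            ∫⁻ θ₂ : Fin N → Tor, ∫⁻ x₂ : Fin N → ℝ,
              ENNReal.ofReal (ψ x₁ x₂ θ₁ θ₂)) ^ r) = ENNReal.ofReal L := by
    have hJ : ∀ θ₁, (∫ x₁, G x₁) ((), θ₁) = ∫ x₁, b x₁ θ₁ ^ r := fun θ₁ =>
      ContinuousMap.integral_apply hGi _
    have hJi : Integrable (fun θ => (∫ x₁, G x₁) ((), θ)) (hmMu M) := by
      refine (integrable_const ‖∫ x₁, G x₁‖).mono' (Continuous.aestronglyMeasurable (by fun_prop))
        (ae_of_all _ fun x => ContinuousMap.norm_coe_le_norm _ _)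
    simp only [L]
    rw [ofReal_integral_eq_lintegral_ofReal hJi (ae_of_all _ fun θ => by
      simp only [Pi.zero_apply]
      rw [hJ]
      exact integral_nonneg fun x₁ => Real.rpow_nonneg (hbpos _ _) _)]
    rw [hmMu, lintegral_smul_measure, smul_eq_mul]
    congr 1
    refine lintegral_congr fun θ₁ => ?_
    rw [hJ, ofReal_integral_eq_lintegral_ofReal (hbi _ continuous_const)
      (ae_of_all _ fun x₁ => Real.rpow_nonneg (hbpos _ _) _)]
    refine lintegral_congr_ae ?_
    filter_upwards [hgood, hae] with x₁ hx hx'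
    rw [hinner x₁ hx hx' θ₁, ENNReal.ofReal_rpow_of_nonneg (hbpos _ _) hr.le]
  rw [hR]
  simp_rw [hL]
  exact (ENNReal.continuous_ofReal.tendsto L).comp hlim

end
end

section
/- Let 1<p₀,p₁,q₀,q₁<∞, α₀,α₁>0, θ∈(0,1), and define 1/p_θ = θ/p₁+(1−θ)/p₀, 1/q_θ = θ/q₁+(1−θ)/q₀, α_θ = θα₁+(1−θ)α₀. Then there exists C>0 such that for all f: ℝ×ℝ→ℂ whose partial Fourier transform in x, ξ ↦ f̂(t,ξ), is smooth and compactly supported in (t,ξ) with support avoiding the line {ξ=0}: ‖|D_x|^{α_θ}f‖_{L^{p_θ}_tL^{q_θ}_x} ≤ C·‖|D_x|^{α₁}f‖_{L^{p₁}_tL^{q₁}_x}^θ·‖|D_x|^{α₀}f‖_{L^{p₀}_tL^{q₀}_x}^{1−θ}. -/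
open MeasureTheory Filter
open scoped ENNReal Topology

noncomputable section

/-- Fourier transform `û(ξ) = (2π)^{-1/2} ∫ u(x) e^{-ixξ} dx`. -/
def ft (u : ℝ → ℂ) (ξ : ℝ) : ℂ :=
  ((Real.sqrt (2 * Real.pi) : ℝ) : ℂ)⁻¹ *
    ∫ x : ℝ, u x * Complex.exp (-(Complex.I * ((x * ξ : ℝ) : ℂ)))

/-- Mixed norm `‖F‖_{L^p_t L^q_x}` valued in `ℝ≥0∞`. -/
def mixedNorm (p q : ℝ) (F : ℝ → ℝ → ℂ) : ℝ≥0∞ :=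
  (∫⁻ t : ℝ, (∫⁻ x : ℝ, (‖F t x‖₊ : ℝ≥0∞) ^ q) ^ (p / q)) ^ (1 / p)

/-- Fractional derivative in `x`:
`(|D_x|^α f)(t,x) = (2π)^{-1/2} ∫ |ξ|^α e^{ixξ} f̂(t,ξ) dξ`. -/
def fracDx (α : ℝ) (f : ℝ → ℝ → ℂ) (t x : ℝ) : ℂ :=
  ((Real.sqrt (2 * Real.pi) : ℝ) : ℂ)⁻¹ *
    ∫ ξ : ℝ, ((|ξ| ^ α : ℝ) : ℂ) *
      Complex.exp (Complex.I * ((x * ξ : ℝ) : ℂ)) * ft (f t) ξ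

/-- Dyadic-radius centred Hardy–Littlewood maximal function. -/
def HLM (v : ℝ → ℝ≥0∞) (x : ℝ) : ℝ≥0∞ :=
  ⨆ k : ℤ, (ENNReal.ofReal (2 * (2:ℝ) ^ k))⁻¹ * ∫⁻ y in Metric.closedBall x ((2:ℝ) ^ k), v y

lemma HLM_measurable {v : ℝ → ℝ≥0∞} (hv : Measurable v) : Measurable (HLM v) := by
  unfold HLM
  refine Measurable.iSup fun k => Measurable.const_mul ?_ _
  have h1 : ∀ x : ℝ, ∫⁻ y in Metric.closedBall x ((2:ℝ) ^ k), v y =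
      ∫⁻ y, ({z : ℝ × ℝ | dist z.2 z.1 ≤ (2:ℝ)^k}.indicator (fun z => v z.2)) (x, y) := by
    intro x
    rw [← lintegral_indicator measurableSet_closedBall]
    rfl
  simp_rw [h1]
  apply Measurable.lintegral_prod_right'
  apply Measurable.indicator (hv.comp measurable_snd)
  exact measurableSet_le (by fun_prop) measurable_const

lemma HLM_le_ball {v : ℝ → ℝ≥0∞} (x : ℝ) (k : ℤ) :
    ∫⁻ y in Metric.closedBall x ((2:ℝ) ^ k), v y ≤ ENNReal.ofReal (2 * (2:ℝ) ^ k) * HLM v x := by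
  have hpos : 0 < (2 * (2:ℝ) ^ k) := by positivity
  have h := le_iSup (fun k : ℤ => (ENNReal.ofReal (2 * (2:ℝ) ^ k))⁻¹ *
    ∫⁻ y in Metric.closedBall x ((2:ℝ) ^ k), v y) k
  calc ∫⁻ y in Metric.closedBall x ((2:ℝ) ^ k), v y
      = ENNReal.ofReal (2 * (2:ℝ) ^ k) * ((ENNReal.ofReal (2 * (2:ℝ) ^ k))⁻¹ *
        ∫⁻ y in Metric.closedBall x ((2:ℝ) ^ k), v y) := by
        rw [← mul_assoc, ENNReal.mul_inv_cancel (by simpa using hpos) ENNReal.ofReal_ne_top, one_mul]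
    _ ≤ _ := by gcongr; exact h

lemma HLM_weak (v : ℝ → ℝ≥0∞) {l : ℝ} (hl : 0 < l) :
    volume {x | ENNReal.ofReal l < HLM v x} ≤ ENNReal.ofReal (5 / l) * ∫⁻ y, v y := by
  by_cases hfin : ∫⁻ y, v y = ∞
  · rw [hfin, ENNReal.mul_top (by simpa using hl)]; exact le_top
  have hk : ∀ x : {x | ENNReal.ofReal l < HLM v x}, ∃ k : ℤ, ENNReal.ofReal l *
      ENNReal.ofReal (2 * (2:ℝ) ^ k) < ∫⁻ y in Metric.closedBall x.1 ((2:ℝ) ^ k), v y := by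
    rintro ⟨x, hx⟩
    simp only [Set.mem_ofPred_eq, HLM, lt_iSup_iff] at hx
    obtain ⟨k, hk⟩ := hx
    refine ⟨k, ?_⟩
    have hpos : 0 < (2 * (2:ℝ) ^ k) := by positivity
    rw [← ENNReal.div_eq_inv_mul] at hk
    rwa [ENNReal.lt_div_iff_mul_lt (Or.inl (by simpa using hpos)) (Or.inl ENNReal.ofReal_ne_top)] at hk
  choose k hk using hk
  set r : {x | ENNReal.ofReal l < HLM v x} → ℝ := fun x => (2:ℝ) ^ (k x) with hr
  have hrpos : ∀ a, 0 < r a := fun a => by simp only [hr]; positivity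
  have hbd : ∀ a ∈ (Set.univ : Set {x | ENNReal.ofReal l < HLM v x}), r a ≤
      (∫⁻ y, v y).toReal / l := by
    intro a _
    rw [le_div_iff₀ hl]
    have h1 := (hk a).le.trans (setLIntegral_le_lintegral _ _)
    rw [← ENNReal.ofReal_mul hl.le, ENNReal.ofReal_le_iff_le_toReal hfin] at h1
    have := hrpos a
    simp only [hr] at *
    nlinarith [mul_pos hl this]
  obtain ⟨u, -, hdisj, hcov⟩ := Vitali.exists_disjoint_subfamily_covering_enlargement_closedBall
    Set.univ (fun a : {x | ENNReal.ofReal l < HLM v x} => a.1) r _ hbd 5 (by norm_num)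
  have hcount : u.Countable := hdisj.countable_of_nonempty_interior fun a _ => by
    refine ⟨a.1, ?_⟩
    exact Metric.ball_subset_interior_closedBall (Metric.mem_ball_self (hrpos a))
  have hsub : {x | ENNReal.ofReal l < HLM v x} ⊆ ⋃ a ∈ u, Metric.closedBall a.1 (5 * r a) := by
    intro x hx
    obtain ⟨b, hb, hsb⟩ := hcov ⟨x, hx⟩ (Set.mem_univ _)
    simp only [Set.mem_iUnion]
    exact ⟨b, hb, hsb (Metric.mem_closedBall_self (hrpos _).le)⟩
  have : Countable u := hcount
  calc volume {x | ENNReal.ofReal l < HLM v x}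
      ≤ volume (⋃ a ∈ u, Metric.closedBall a.1 (5 * r a)) := measure_mono hsub
    _ ≤ ∑' a : u, volume (Metric.closedBall a.1.1 (5 * r a.1)) := measure_biUnion_le _ hcount _
    _ ≤ ∑' a : u, ENNReal.ofReal (5 / l) * ∫⁻ y in Metric.closedBall a.1.1 (r a.1), v y := by
        refine ENNReal.tsum_le_tsum fun a => ?_
        rw [Real.volume_closedBall]
        calc ENNReal.ofReal (2 * (5 * r a.1)) = ENNReal.ofReal (5 / l) * (ENNReal.ofReal l *
              ENNReal.ofReal (2 * (2:ℝ) ^ (k a.1))) := by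
              rw [← ENNReal.ofReal_mul hl.le, ← ENNReal.ofReal_mul (by positivity)]
              congr 1
              simp only [hr]; field_simp
          _ ≤ _ := by gcongr; exact (hk a.1).le
    _ = ENNReal.ofReal (5 / l) * ∑' a : u, ∫⁻ y in Metric.closedBall a.1.1 (r a.1), v y :=
        ENNReal.tsum_mul_left
    _ = ENNReal.ofReal (5 / l) * ∫⁻ y in ⋃ a ∈ u, Metric.closedBall a.1 (r a), v y := by
        rw [lintegral_biUnion hcount (fun a _ => measurableSet_closedBall) hdisj]
    _ ≤ _ := by gcongr; exact Measure.restrict_le_self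

lemma HLM_le_of_le {v : ℝ → ℝ≥0∞} {w : ℝ → ℝ≥0∞} {b : ℝ≥0∞} (hw : Measurable w)
    (h : ∀ x, v x ≤ w x + b) (x : ℝ) : HLM v x ≤ HLM w x + b := by
  refine iSup_le fun k => ?_
  have hpos : 0 < (2 * (2:ℝ) ^ k) := by positivity
  calc (ENNReal.ofReal (2 * (2:ℝ) ^ k))⁻¹ * ∫⁻ y in Metric.closedBall x ((2:ℝ) ^ k), v y
      ≤ (ENNReal.ofReal (2 * (2:ℝ) ^ k))⁻¹ * ∫⁻ y in Metric.closedBall x ((2:ℝ) ^ k), (w y + b) := by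
        gcongr with y; exact h y
    _ = (ENNReal.ofReal (2 * (2:ℝ) ^ k))⁻¹ * (∫⁻ y in Metric.closedBall x ((2:ℝ) ^ k), w y) + b := by
        rw [lintegral_add_left hw, mul_add]
        congr 1
        rw [setLIntegral_const, Real.volume_closedBall, mul_comm b, ← mul_assoc,
          ENNReal.inv_mul_cancel (by simpa using hpos) ENNReal.ofReal_ne_top, one_mul]
    _ ≤ _ := by
        gcongr
        exact le_iSup (fun k : ℤ => (ENNReal.ofReal (2 * (2:ℝ) ^ k))⁻¹ *
          ∫⁻ y in Metric.closedBall x ((2:ℝ) ^ k), w y) k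

lemma HLM_zero (x : ℝ) : HLM (fun _ => 0) x = 0 := by simp [HLM]

lemma HLM_le_const {v : ℝ → ℝ≥0∞} {b : ℝ≥0∞} (h : ∀ x, v x ≤ b) (x : ℝ) : HLM v x ≤ b := by
  have := HLM_le_of_le (v := v) (w := fun _ => 0) (b := b) measurable_const (by simpa using h) x
  simpa [HLM_zero] using this

lemma HLM_weak' {v : ℝ → ℝ} (hv : Measurable v) {l : ℝ} (hl : 0 < l) :
    volume {x | ENNReal.ofReal l < HLM (fun x => ENNReal.ofReal (v x)) x} ≤
      ENNReal.ofReal (10 / l) * ∫⁻ y, {y | l < 2 * v y}.indicator (fun y => ENNReal.ofReal (v y)) y := by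
  have hms : MeasurableSet {y | l < 2 * v y} := measurableSet_lt measurable_const (by fun_prop)
  have hm : Measurable ({y | l < 2 * v y}.indicator (fun y => ENNReal.ofReal (v y))) :=
    Measurable.indicator (by fun_prop) hms
  have h10 : 10 / l = 5 / (l / 2) := by field_simp; norm_num
  rw [h10]
  refine le_trans (measure_mono ?_) (HLM_weak _ (half_pos hl))
  intro x hx
  simp only [Set.mem_ofPred_eq] at hx ⊢
  have := HLM_le_of_le (v := fun x => ENNReal.ofReal (v x)) (b := ENNReal.ofReal (l/2)) hm
    (fun y => by
      by_cases h : l < 2 * v y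
      · rw [Set.indicator_of_mem (by exact h)]; exact le_self_add
      · refine le_add_left (ENNReal.ofReal_le_ofReal ?_)
        linarith) x
  have h2 := hx.trans_le this
  have h3 : ENNReal.ofReal l = ENNReal.ofReal (l/2) + ENNReal.ofReal (l/2) := by
    rw [← ENNReal.ofReal_add (by positivity) (by positivity)]; congr 1; ring
  rw [h3] at h2
  exact (ENNReal.add_lt_add_iff_right (by simp)).1 h2

lemma lint_rpow_Ioc {s R : ℝ} (hs : -1 < s) (hR : 0 ≤ R) :
    ∫⁻ t in Set.Ioc 0 R, ENNReal.ofReal (t ^ s) = ENNReal.ofReal (R ^ (s+1) / (s+1)) := by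
  have hi : IntervalIntegrable (fun t : ℝ => t ^ s) volume 0 R :=
    intervalIntegral.intervalIntegrable_rpow' hs
  rw [intervalIntegrable_iff_integrableOn_Ioc_of_le hR] at hi
  rw [← ofReal_integral_eq_lintegral_ofReal hi, ← intervalIntegral.integral_of_le hR,
    integral_rpow (Or.inl hs), Real.zero_rpow (by linarith), sub_zero]
  filter_upwards [ae_restrict_mem measurableSet_Ioc] with t ht
  exact Real.rpow_nonneg ht.1.le _

lemma lint_rpow_Ioi {s R : ℝ} (hs : s < -1) (hR : 0 < R) :
    ∫⁻ t in Set.Ioi R, ENNReal.ofReal (t ^ s) = ENNReal.ofReal (-R ^ (s+1) / (s+1)) := by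
  rw [← ofReal_integral_eq_lintegral_ofReal (integrableOn_Ioi_rpow_of_lt hs hR),
    integral_Ioi_rpow_of_lt hs hR]
  filter_upwards [ae_restrict_mem measurableSet_Ioi] with t ht
  exact Real.rpow_nonneg (hR.trans ht).le _

lemma HLM_strong {q : ℝ} (hq : 1 < q) {v : ℝ → ℝ} (hv : Measurable v) (hv0 : ∀ x, 0 ≤ v x) {b : ℝ}
    (hb : ∀ x, v x ≤ b) :
    ∫⁻ x, HLM (fun x => ENNReal.ofReal (v x)) x ^ q ≤
      ENNReal.ofReal (q * (10 * (2 ^ (q-1) / (q-1)))) * ∫⁻ x, ENNReal.ofReal (v x) ^ q := by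
  set M := HLM (fun x => ENNReal.ofReal (v x)) with hM
  have hfin : ∀ x, M x ≠ ∞ := fun x => ne_top_of_le_ne_top ENNReal.ofReal_ne_top
    (HLM_le_const (fun x => ENNReal.ofReal_le_ofReal (hb x)) x)
  have hMm : Measurable M := HLM_measurable (by fun_prop)
  have e1 : ∀ x, M x ^ q = ENNReal.ofReal ((M x).toReal ^ q) := fun x => by
    rw [← ENNReal.ofReal_rpow_of_nonneg ENNReal.toReal_nonneg (by linarith),
      ENNReal.ofReal_toReal (hfin x)]
  simp_rw [e1]
  rw [lintegral_rpow_eq_lintegral_meas_lt_mul volume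
    (Eventually.of_forall fun x => ENNReal.toReal_nonneg) hMm.ennreal_toReal.aemeasurable
    (by linarith)]
  rw [ENNReal.ofReal_mul (by linarith), mul_assoc]
  gcongr
  calc ∫⁻ t in Set.Ioi 0, volume {a | t < (M a).toReal} * ENNReal.ofReal (t ^ (q-1))
      ≤ ∫⁻ t in Set.Ioi 0, ∫⁻ y, {z : ℝ × ℝ | z.1 ≤ 2 * v z.2}.indicator
          (fun z => ENNReal.ofReal (v z.2) * ENNReal.ofReal 10 * ENNReal.ofReal (z.1 ^ (q-2))) (t, y) := by
        refine setLIntegral_mono' measurableSet_Ioi fun t ht => ?_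
        have ht : 0 < t := ht
        have e2 : {a | t < (M a).toReal} = {a | ENNReal.ofReal t < M a} := by
          ext a; simp [ENNReal.ofReal_lt_iff_lt_toReal ht.le (hfin a)]
        rw [e2, mul_comm]
        refine (mul_le_mul_right (HLM_weak' hv ht) _).trans ?_
        rw [← mul_assoc, ← ENNReal.ofReal_mul (by positivity), ← lintegral_const_mul]
        · refine lintegral_mono fun y => ?_
          by_cases h : t < 2 * v y
          · rw [Set.indicator_of_mem (by exact h), Set.indicator_of_mem (by exact h.le)]
            apply le_of_eq
            simp only
            rw [← ENNReal.ofReal_mul (hv0 y), ← ENNReal.ofReal_mul (by positivity),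
              ← ENNReal.ofReal_mul (by linarith [hv0 y])]
            congr 1
            rw [show q - 1 = (q - 2) + 1 by ring, Real.rpow_add_one ht.ne']
            field_simp
          · rw [Set.indicator_of_notMem (by exact h), mul_zero]; exact zero_le
        · exact Measurable.indicator (by fun_prop)
            (measurableSet_lt measurable_const (by fun_prop))
    _ = ∫⁻ y, ∫⁻ t in Set.Ioi 0, {z : ℝ × ℝ | z.1 ≤ 2 * v z.2}.indicator
          (fun z => ENNReal.ofReal (v z.2) * ENNReal.ofReal 10 * ENNReal.ofReal (z.1 ^ (q-2))) (t, y) := by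
        rw [lintegral_lintegral_swap]
        apply Measurable.aemeasurable
        exact Measurable.indicator (by fun_prop)
            (measurableSet_le (by fun_prop) (by fun_prop))
    _ = ∫⁻ y, ENNReal.ofReal (10 * (2 ^ (q-1) / (q-1))) * ENNReal.ofReal (v y) ^ q := by
        refine lintegral_congr fun y => ?_
        have e3 : ∀ t, {z : ℝ × ℝ | z.1 ≤ 2 * v z.2}.indicator
          (fun z => ENNReal.ofReal (v z.2) * ENNReal.ofReal 10 * ENNReal.ofReal (z.1 ^ (q-2))) (t, y)
           = (Set.Iic (2 * v y)).indicator (fun t => ENNReal.ofReal (v y) * ENNReal.ofReal 10 *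
              ENNReal.ofReal (t ^ (q-2))) t := fun t => rfl
        simp_rw [e3]
        rw [setLIntegral_indicator measurableSet_Iic, Set.inter_comm, Set.Ioi_inter_Iic,
          lintegral_const_mul _ (by fun_prop), lint_rpow_Ioc (by linarith) (by linarith [hv0 y]),
          ENNReal.ofReal_rpow_of_nonneg (hv0 y) (by linarith),
          ← ENNReal.ofReal_mul (hv0 y), ← ENNReal.ofReal_mul (by linarith [hv0 y]),
          ← ENNReal.ofReal_mul]
        · congr 1
          rw [show q - 2 + 1 = q - 1 by ring, Real.mul_rpow (by norm_num) (hv0 y)]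
          have : v y ^ q = v y ^ (q-1) * v y := by
            rcases (hv0 y).eq_or_lt with h | h
            · rw [← h, Real.zero_rpow (by linarith), mul_zero]
            · rw [← Real.rpow_add_one h.ne']; congr 1; ring
          rw [this]; ring
        · have : 0 < q - 1 := by linarith
          positivity
    _ = _ := by rw [lintegral_const_mul _ (by fun_prop)]

lemma lint_affine {F : ℝ → ℝ≥0∞} (hF : Measurable F) (x : ℝ) {τ : ℝ} (hτ : 0 < τ) :
    ∫⁻ y, F (x - τ * y) = ENNReal.ofReal τ⁻¹ * ∫⁻ z, F z := by
  have h1 := Real.smul_map_volume_mul_left hτ.ne'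
  rw [abs_of_pos hτ] at h1
  calc ∫⁻ y, F (x - τ * y) = ∫⁻ y, F (x - y) ∂(Measure.map (τ * ·) volume) := by
        rw [lintegral_map (by fun_prop) (by fun_prop)]
    _ = ENNReal.ofReal τ⁻¹ * (ENNReal.ofReal τ * ∫⁻ y, F (x - y) ∂(Measure.map (τ * ·) volume)) := by
        rw [← mul_assoc, ← ENNReal.ofReal_mul (by positivity), inv_mul_cancel₀ hτ.ne']; simp
    _ = ENNReal.ofReal τ⁻¹ * ∫⁻ y, F (x - y) ∂(ENNReal.ofReal τ • Measure.map (τ * ·) volume) := by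
        rw [lintegral_smul_measure]; rfl
    _ = _ := by rw [h1, lintegral_sub_left_eq_self]

lemma ball_avg_le {v : ℝ → ℝ≥0∞} (hv : Measurable v) (x : ℝ) {τ : ℝ} (hτ : 0 < τ) (k : ℕ) :
    ∫⁻ y, {y : ℝ | |y| ≤ 2 ^ k}.indicator (fun y => v (x - τ * y)) y ≤
      ENNReal.ofReal (4 * 2 ^ k) * HLM v x := by
  have e1 : ∀ y : ℝ, {y : ℝ | |y| ≤ 2 ^ k}.indicator (fun y => v (x - τ * y)) y =
      (Metric.closedBall x (τ * 2 ^ k)).indicator v (x - τ * y) := by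
    intro y
    have : |y| ≤ 2 ^ k ↔ x - τ * y ∈ Metric.closedBall x (τ * 2 ^ k) := by
      rw [Metric.mem_closedBall, Real.dist_eq, show x - τ * y - x = -(τ * y) by ring, abs_neg,
        abs_mul, abs_of_pos hτ, mul_le_mul_iff_right₀ hτ]
    by_cases h : |y| ≤ 2 ^ k
    · rw [Set.indicator_of_mem (by exact h), Set.indicator_of_mem (this.1 h)]
    · rw [Set.indicator_of_notMem (by exact h), Set.indicator_of_notMem (fun h' => h (this.2 h'))]
  simp_rw [e1]
  rw [lint_affine (hv.indicator measurableSet_closedBall) x hτ,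
    lintegral_indicator measurableSet_closedBall]
  obtain ⟨j, hj1, hj2⟩ := exists_mem_Ico_zpow (x := τ * 2 ^ k) (y := 2) (by positivity) (by norm_num)
  have hsub : Metric.closedBall x (τ * 2 ^ k) ⊆ Metric.closedBall x ((2:ℝ) ^ (j+1)) :=
    Metric.closedBall_subset_closedBall hj2.le
  calc ENNReal.ofReal τ⁻¹ * ∫⁻ y in Metric.closedBall x (τ * 2 ^ k), v y
      ≤ ENNReal.ofReal τ⁻¹ * ∫⁻ y in Metric.closedBall x ((2:ℝ) ^ (j+1)), v y := by
        gcongr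
    _ ≤ ENNReal.ofReal τ⁻¹ * (ENNReal.ofReal (2 * (2:ℝ) ^ (j+1)) * HLM v x) := by
        gcongr; exact HLM_le_ball x _
    _ ≤ _ := by
        rw [← mul_assoc, ← ENNReal.ofReal_mul (by positivity)]
        refine mul_le_mul_left (ENNReal.ofReal_le_ofReal ?_) _
        rw [zpow_add_one₀ (by norm_num)]
        rw [inv_mul_le_iff₀ hτ]
        linarith

lemma conv_le_HLM {v : ℝ → ℝ≥0∞} (hv : Measurable v) (x : ℝ) {τ : ℝ} (hτ : 0 < τ) :
    ∫⁻ y, ENNReal.ofReal (1 / (1 + y ^ 2)) * v (x - τ * y) ≤ ENNReal.ofReal 32 * HLM v x := by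
  have hpt : ∀ y : ℝ, ENNReal.ofReal (1 / (1 + y ^ 2)) * v (x - τ * y) ≤
      ∑' k : ℕ, ENNReal.ofReal (4 * (1/4) ^ k) *
        {y : ℝ | |y| ≤ 2 ^ k}.indicator (fun y => v (x - τ * y)) y := by
    intro y
    have : ∃ k : ℕ, |y| ≤ 2 ^ k ∧ 1 / (1 + y ^ 2) ≤ 4 * (1/4 : ℝ) ^ k := by
      rcases le_or_gt |y| 1 with h | h
      · refine ⟨0, by simpa using h, ?_⟩
        rw [div_le_iff₀ (by positivity)]
        nlinarith [sq_nonneg y]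
      · obtain ⟨n, hn1, hn2⟩ := exists_nat_pow_near h.le (y := 2) (by norm_num)
        refine ⟨n + 1, hn2.le, ?_⟩
        have h4 : (4:ℝ) ^ n ≤ y ^ 2 := by
          have : ((2:ℝ) ^ n) ^ 2 ≤ |y| ^ 2 := by gcongr
          rw [sq_abs, ← pow_mul, mul_comm, pow_mul] at this
          norm_num at this; exact this
        rw [div_le_iff₀ (by positivity), one_div, inv_pow, pow_succ, mul_inv]
        have h5 : (0:ℝ) < 4 ^ n := by positivity
        rw [show 4 * (((4:ℝ) ^ n)⁻¹ * 4⁻¹) * (1 + y ^ 2) = (1 + y ^ 2) / 4 ^ n by field_simp,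
          le_div_iff₀ h5]
        linarith
    obtain ⟨k, hk1, hk2⟩ := this
    refine le_trans ?_ (ENNReal.le_tsum k)
    rw [Set.indicator_of_mem (by exact hk1)]
    gcongr
  calc _ ≤ ∫⁻ y, ∑' k : ℕ, ENNReal.ofReal (4 * (1/4) ^ k) *
        {y : ℝ | |y| ≤ 2 ^ k}.indicator (fun y => v (x - τ * y)) y := lintegral_mono hpt
    _ = ∑' k : ℕ, ENNReal.ofReal (4 * (1/4) ^ k) *
        ∫⁻ y, {y : ℝ | |y| ≤ 2 ^ k}.indicator (fun y => v (x - τ * y)) y := by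
        have hm : ∀ k : ℕ, Measurable ({y : ℝ | |y| ≤ 2 ^ k}.indicator (fun y => v (x - τ * y))) :=
          fun k => Measurable.indicator (by fun_prop)
            (measurableSet_le (by fun_prop) measurable_const)
        rw [lintegral_tsum fun k => ((hm k).const_mul _).aemeasurable]
        congr 1; ext k
        rw [lintegral_const_mul _ (hm k)]
    _ ≤ ∑' k : ℕ, ENNReal.ofReal (16 * (1/2) ^ k) * HLM v x := by
        refine ENNReal.tsum_le_tsum fun k => ?_
        refine (mul_le_mul_right (ball_avg_le hv x hτ k) _).trans ?_
        rw [← mul_assoc, ← ENNReal.ofReal_mul (by positivity)]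
        refine mul_le_mul_left (ENNReal.ofReal_le_ofReal ?_) _
        apply le_of_eq
        rw [show (1/4:ℝ) = 1/2 * (1/2) by norm_num, mul_pow,
          show 4 * ((1/2:ℝ)^k * (1/2)^k) * (4 * 2 ^ k) = 16 * (1/2)^k * ((1/2)^k * 2 ^ k) by ring,
          ← mul_pow]
        norm_num
    _ = _ := by
        rw [ENNReal.tsum_mul_right]
        congr 1
        rw [← ENNReal.ofReal_tsum_of_nonneg (fun n => by positivity)
          (summable_geometric_two.mul_left _), tsum_mul_left, tsum_geometric_two]
        norm_num

/-- Unnormalised inverse Fourier integral. -/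
def Eh (h : ℝ → ℂ) (x : ℝ) : ℂ := ∫ ξ : ℝ, Complex.exp (Complex.I * ((x * ξ : ℝ) : ℂ)) * h ξ

lemma norm_exp_I (a : ℝ) : ‖Complex.exp (Complex.I * (a : ℂ))‖ = 1 := by
  rw [mul_comm]; exact Complex.norm_exp_ofReal_mul_I a

lemma Eh_bound (h : ℝ → ℂ) (x : ℝ) : ‖Eh h x‖ ≤ ∫ ξ, ‖h ξ‖ := by
  refine (norm_integral_le_integral_norm _).trans (le_of_eq ?_)
  simp only [norm_mul, norm_exp_I, one_mul]

lemma Eh_cont {h : ℝ → ℂ} (hh : Integrable h) : Continuous (Eh h) := by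
  refine continuous_of_dominated (bound := fun ξ => ‖h ξ‖) ?_ ?_ hh.norm ?_
  · intro x
    exact AEStronglyMeasurable.mul (by fun_prop) hh.1
  · intro x
    refine Eventually.of_forall fun ξ => ?_
    rw [norm_mul, norm_exp_I, one_mul]
  · exact Eventually.of_forall fun ξ => by fun_prop

lemma schwartz_bound (K : SchwartzMap ℝ ℂ) : ∃ C : ℝ, 0 < C ∧ ∀ y, ‖K y‖ ≤ C * (1 / (1 + y ^ 2)) := by
  obtain ⟨C0, hC0, h0⟩ := K.decay 0 0
  obtain ⟨C2, hC2, h2⟩ := K.decay 2 0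
  refine ⟨C0 + C2, by positivity, fun y => ?_⟩
  have a := h0 y
  have b := h2 y
  simp only [norm_iteratedFDeriv_zero, pow_zero, one_mul, Real.norm_eq_abs, sq_abs] at a b
  rw [mul_one_div, le_div_iff₀ (by positivity)]
  linarith

open scoped FourierTransform in
lemma kernel_bound (ψ : ℝ → ℂ) (hψ : ContDiff ℝ (⊤ : ℕ∞) ψ) (hc : HasCompactSupport ψ) :
    ∃ C : ℝ, 0 < C ∧ ∀ τ : ℝ, 0 < τ → ∀ h : ℝ → ℂ, Integrable h → ∀ x : ℝ,
      ‖Eh (fun ξ => ψ (τ * ξ) * h ξ) x‖ₑ ≤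
        ENNReal.ofReal C * HLM (fun y => ENNReal.ofReal ‖Eh h y‖) x := by
  set m : SchwartzMap ℝ ℂ := hc.toSchwartzMap hψ with hm
  have hmψ : ∀ ξ, m ξ = ψ ξ := fun ξ => rfl
  set K : SchwartzMap ℝ ℂ := 𝓕⁻ m with hK
  have hKm : 𝓕 K = m := by rw [hK]; exact FourierTransform.fourier_fourierInv_eq m
  obtain ⟨C, hC, hKb⟩ := schwartz_bound K
  have hψK : ∀ ξ, ψ ξ = ∫ y : ℝ, Complex.exp (Complex.I * ((-2 * Real.pi * y * ξ : ℝ) : ℂ)) * K y := by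
    intro ξ
    rw [← hmψ, ← hKm, SchwartzMap.fourier_coe, Real.fourier_real_eq_integral_exp_smul]
    refine integral_congr_ae (Eventually.of_forall fun y => ?_)
    simp only [smul_eq_mul]
    rw [mul_comm Complex.I]
  refine ⟨C * 32, by positivity, fun τ hτ h hh x => ?_⟩
  have hEm : Measurable fun y => ENNReal.ofReal ‖Eh h y‖ :=
    (Eh_cont hh).norm.measurable.ennreal_ofReal
  have key : Eh (fun ξ => ψ (τ * ξ) * h ξ) x = ∫ y, K y * Eh h (x - (2 * Real.pi * τ) * y) := by
    have hprodI : Integrable (Function.uncurry fun (ξ y : ℝ) =>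
        Complex.exp (Complex.I * ((x * ξ - 2 * Real.pi * y * (τ * ξ) : ℝ) : ℂ)) * (h ξ * K y))
        (volume.prod volume) := by
      have h1 := (hh.mul_prod K.integrable (μ := volume) (ν := volume))
      refine h1.mono ?_ ?_
      · refine AEStronglyMeasurable.mul ?_ h1.1
        apply Continuous.aestronglyMeasurable
        fun_prop
      · refine Eventually.of_forall fun z => ?_
        simp only [Function.uncurry]
        rw [norm_mul, norm_exp_I, one_mul]
    calc Eh (fun ξ => ψ (τ * ξ) * h ξ) x
        = ∫ ξ : ℝ, ∫ y : ℝ,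
          Complex.exp (Complex.I * ((x * ξ - 2 * Real.pi * y * (τ * ξ) : ℝ) : ℂ)) * (h ξ * K y) := by
          refine integral_congr_ae (Eventually.of_forall fun ξ => ?_)
          simp only
          rw [hψK, ← integral_mul_const, ← integral_const_mul]
          refine integral_congr_ae (Eventually.of_forall fun y => ?_)
          simp only
          rw [show Complex.I * ((x * ξ - 2 * Real.pi * y * (τ * ξ) : ℝ) : ℂ) =
            Complex.I * ((x * ξ : ℝ) : ℂ) +
              Complex.I * ((-2 * Real.pi * y * (τ * ξ) : ℝ) : ℂ) by push_cast; ring, Complex.exp_add]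
          ring
      _ = ∫ y : ℝ, ∫ ξ : ℝ,
          Complex.exp (Complex.I * ((x * ξ - 2 * Real.pi * y * (τ * ξ) : ℝ) : ℂ)) * (h ξ * K y) :=
          integral_integral_swap hprodI
      _ = _ := by
          refine integral_congr_ae (Eventually.of_forall fun y => ?_)
          simp only [Eh]
          rw [← integral_const_mul]
          refine integral_congr_ae (Eventually.of_forall fun ξ => ?_)
          simp only
          rw [show (x - 2 * Real.pi * τ * y) * ξ = x * ξ - 2 * Real.pi * y * (τ * ξ) by ring]
          ring
  rw [key]
  calc ‖∫ y, K y * Eh h (x - (2 * Real.pi * τ) * y)‖ₑ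
      ≤ ∫⁻ y, ‖K y * Eh h (x - (2 * Real.pi * τ) * y)‖ₑ := enorm_integral_le_lintegral_enorm _
    _ ≤ ∫⁻ y, ENNReal.ofReal C * (ENNReal.ofReal (1 / (1 + y ^ 2)) *
          ENNReal.ofReal ‖Eh h (x - (2 * Real.pi * τ) * y)‖) := by
        refine lintegral_mono fun y => ?_
        rw [enorm_mul, ← mul_assoc, ← ENNReal.ofReal_mul hC.le, ofReal_norm]
        gcongr
        rw [← ofReal_norm]
        exact ENNReal.ofReal_le_ofReal (hKb y)
    _ = ENNReal.ofReal C * ∫⁻ y, (ENNReal.ofReal (1 / (1 + y ^ 2)) *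
          ENNReal.ofReal ‖Eh h (x - (2 * Real.pi * τ) * y)‖) := by
        rw [lintegral_const_mul]
        exact Measurable.mul (by fun_prop) (hEm.comp (by fun_prop))
    _ ≤ _ := by
        refine (mul_le_mul_right (conv_le_HLM hEm x (by positivity)) _).trans (le_of_eq ?_)
        rw [ENNReal.ofReal_mul hC.le, mul_assoc]

lemma min_integral {β θ : ℝ} (hβ : 0 < β) (hθ0 : 0 < θ) (hθ1 : θ < 1) {A B : ℝ≥0∞} (hA : A ≠ ∞)
    (hB : B ≠ ∞) {W : ℝ → ℝ≥0∞} (h1 : ∀ τ, 0 < τ → W τ ≤ A)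
    (h2 : ∀ τ, 0 < τ → W τ ≤ ENNReal.ofReal (τ ^ β) * B) :
    ∫⁻ τ in Set.Ioi 0, ENNReal.ofReal (τ ^ (-(θ * β) - 1)) * W τ ≤
      ENNReal.ofReal (1 / ((1 - θ) * β) + 1 / (θ * β)) * (A ^ (1 - θ) * B ^ θ) := by
  have hθ' : 0 < 1 - θ := by linarith
  by_cases h0 : A = 0 ∨ B = 0
  · have : ∀ τ, 0 < τ → W τ = 0 := by
      intro τ hτ
      rcases h0 with h | h
      · simpa [h] using h1 τ hτ
      · simpa [h] using h2 τ hτ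
    rw [setLIntegral_congr_fun (g := fun _ => 0) measurableSet_Ioi
      (fun τ hτ => by simp [this τ hτ])]
    simp
  push Not at h0
  lift A to NNReal using hA
  lift B to NNReal using hB
  obtain ⟨hA0, hB0⟩ := h0
  have a0 : 0 < (A:ℝ) := by
    have : A ≠ 0 := by simpa using hA0
    positivity
  have b0 : 0 < (B:ℝ) := by
    have : B ≠ 0 := by simpa using hB0
    positivity
  have eA : (A : ℝ≥0∞) = ENNReal.ofReal (A:ℝ) := by simp
  have eB : (B : ℝ≥0∞) = ENNReal.ofReal (B:ℝ) := by simp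
  rw [eA] at h1 ⊢
  rw [eB] at h2 ⊢
  generalize (A:ℝ) = a at *
  generalize (B:ℝ) = b at *
  set R : ℝ := (a / b) ^ (1 / β) with hR
  have hR0 : 0 < R := by positivity
  rw [← Set.Ioc_union_Ioi_eq_Ioi hR0.le, lintegral_union measurableSet_Ioi
    (Set.Ioc_disjoint_Ioi le_rfl)]
  have i1 : ∫⁻ τ in Set.Ioc 0 R, ENNReal.ofReal (τ ^ (-(θ * β) - 1)) * W τ ≤
      ENNReal.ofReal (1 / ((1 - θ) * β) * (a ^ (1-θ) * b ^ θ)) := by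
    calc _ ≤ ∫⁻ τ in Set.Ioc 0 R, ENNReal.ofReal b * ENNReal.ofReal (τ ^ ((1 - θ) * β - 1)) := by
          refine setLIntegral_mono' measurableSet_Ioc fun τ hτ => ?_
          refine (mul_le_mul_right (h2 τ hτ.1) _).trans (le_of_eq ?_)
          have := hτ.1
          rw [← ENNReal.ofReal_mul (by positivity), ← ENNReal.ofReal_mul (by positivity),
            ← ENNReal.ofReal_mul b0.le]
          congr 1
          rw [show (1 - θ) * β - 1 = (-(θ * β) - 1) + β by ring, Real.rpow_add hτ.1]
          ring
      _ = _ := by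
          have hx : 0 < (1 - θ) * β := by positivity
          rw [lintegral_const_mul _ (by fun_prop), lint_rpow_Ioc (by linarith) hR0.le,
            ← ENNReal.ofReal_mul b0.le]
          congr 1
          rw [show (1 - θ) * β - 1 + 1 = (1 - θ) * β by ring, hR, ← Real.rpow_mul (by positivity),
            show 1 / β * ((1 - θ) * β) = 1 - θ by field_simp, Real.div_rpow a0.le b0.le,
            Real.rpow_sub b0, Real.rpow_one]
          field_simp
  have i2 : ∫⁻ τ in Set.Ioi R, ENNReal.ofReal (τ ^ (-(θ * β) - 1)) * W τ ≤
      ENNReal.ofReal (1 / (θ * β) * (a ^ (1-θ) * b ^ θ)) := by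
    calc _ ≤ ∫⁻ τ in Set.Ioi R, ENNReal.ofReal a * ENNReal.ofReal (τ ^ (-(θ * β) - 1)) := by
          refine setLIntegral_mono' measurableSet_Ioi fun τ hτ => ?_
          refine (mul_le_mul_right (h1 τ (hR0.trans hτ)) _).trans (le_of_eq (mul_comm _ _))
      _ = _ := by
          have hx : 0 < θ * β := by positivity
          rw [lintegral_const_mul _ (by fun_prop), lint_rpow_Ioi (by linarith) hR0,
            ← ENNReal.ofReal_mul a0.le]
          congr 1
          rw [show -(θ * β) - 1 + 1 = -(θ * β) by ring, hR, ← Real.rpow_mul (by positivity),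
            show 1 / β * (-(θ * β)) = -θ by field_simp, Real.div_rpow a0.le b0.le,
            Real.rpow_sub a0, Real.rpow_one, Real.rpow_neg a0.le, Real.rpow_neg b0.le]
          field_simp
  refine (add_le_add i1 i2).trans (le_of_eq ?_)
  rw [ENNReal.ofReal_rpow_of_pos a0, ENNReal.ofReal_rpow_of_pos b0,
    ← ENNReal.ofReal_mul (by positivity), ← ENNReal.ofReal_mul (by positivity),
    ← ENNReal.ofReal_add (by positivity) (by positivity), add_mul]

/-- A nonnegative even bump supported in `1 ≤ |s| ≤ 2`. -/
lemma exists_bump : ∃ m : ℝ → ℝ, ContDiff ℝ (⊤ : ℕ∞) m ∧ (∀ s, 0 ≤ m s) ∧ (∀ s, m |s| = m s) ∧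
    (∀ s, |s| ≤ 1 → m s = 0) ∧ (∀ s, 2 ≤ |s| → m s = 0) ∧ m (3/2) ≠ 0 := by
  let ψ : ContDiffBump (3/2 : ℝ) := ⟨1/4, 1/2, by norm_num, by norm_num⟩
  have hz : ∀ s : ℝ, 1/2 ≤ |s - 3/2| → ψ s = 0 := fun s hs => by
    apply ψ.zero_of_le_dist; simpa [Real.dist_eq, ψ] using hs
  refine ⟨fun s => ψ s + ψ (-s), ?_, ?_, ?_, ?_, ?_, ?_⟩
  · exact ψ.contDiff.add (ψ.contDiff.comp contDiff_neg)
  · intro s; exact add_nonneg ψ.nonneg ψ.nonneg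
  · intro s
    rcases abs_choice s with h | h <;> simp only [h, neg_neg]
    exact add_comm _ _
  · intro s hs
    have := abs_le.1 hs
    simp only
    rw [hz s (by rw [abs_of_nonpos] <;> linarith), hz (-s) (by rw [abs_of_nonpos] <;> linarith),
      add_zero]
  · intro s hs
    simp only
    rcases le_abs.1 hs with h | h
    · rw [hz s (by rw [abs_of_nonneg] <;> linarith), hz (-s) (by rw [abs_of_nonpos] <;> linarith),
        add_zero]
    · rw [hz s (by rw [abs_of_nonpos] <;> linarith), hz (-s) (by rw [abs_of_nonneg] <;> linarith),
        add_zero]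
  · have : ψ (3/2) = 1 := ψ.one_of_mem_closedBall (by simp [ψ])
    simp only [this]
    have h2 : 0 ≤ ψ (-(3/2)) := ψ.nonneg
    positivity

lemma bump_smooth {m : ℝ → ℝ} (hm : ContDiff ℝ (⊤ : ℕ∞) m) (h1 : ∀ s, |s| ≤ 1 → m s = 0) (β : ℝ) :
    ContDiff ℝ (⊤ : ℕ∞) (fun s => ((m s * |s| ^ (-β) : ℝ) : ℂ)) := by
  refine Complex.ofRealCLM.contDiff.comp ?_
  rw [contDiff_iff_contDiffAt]
  intro s
  by_cases hs : s = 0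
  · subst hs
    refine (contDiffAt_const (c := (0:ℝ))).congr_of_eventuallyEq ?_
    filter_upwards [Metric.ball_mem_nhds (0:ℝ) one_pos] with s hs
    have : |s| < 1 := by simpa using hs
    rw [h1 s this.le]; exact zero_mul _
  · exact hm.contDiffAt.mul ((contDiffAt_abs hs).rpow_const_of_ne (abs_ne_zero.2 hs))

lemma bump_compact {m : ℝ → ℝ} (h2 : ∀ s, 2 ≤ |s| → m s = 0) (β : ℝ) :
    HasCompactSupport (fun s => ((m s * |s| ^ (-β) : ℝ) : ℂ)) := by
  refine HasCompactSupport.intro (isCompact_closedBall (0:ℝ) 2) fun s hs => ?_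
  have : 2 < |s| := by simpa using hs
  rw [h2 s this.le]; simp

lemma bump_integral {m : ℝ → ℝ} (hev : ∀ s, m |s| = m s) (h1 : ∀ s, |s| ≤ 1 → m s = 0) {γ : ℝ}
    (hγ : 0 < γ) (ξ : ℝ) :
    ∫ τ in Set.Ioi 0, τ ^ (-γ - 1) * m (τ * ξ) =
      (∫ s in Set.Ioi 0, s ^ (-γ - 1) * m s) * |ξ| ^ γ := by
  by_cases hξ : ξ = 0
  · subst hξ
    simp [h1 0 (by simp), Real.zero_rpow hγ.ne']
  have hp : 0 < |ξ| := abs_pos.2 hξ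
  have e := integral_comp_mul_left_Ioi (fun s => s ^ (-γ - 1) * m s) 0 hp
  rw [mul_zero] at e
  have e2 : ∫ τ in Set.Ioi 0, (|ξ| * τ) ^ (-γ - 1) * m (|ξ| * τ) =
      |ξ| ^ (-γ - 1) * ∫ τ in Set.Ioi 0, τ ^ (-γ - 1) * m (τ * ξ) := by
    rw [← integral_const_mul]
    refine setIntegral_congr_fun measurableSet_Ioi fun τ hτ => ?_
    have hτ : 0 < τ := hτ
    rw [Real.mul_rpow hp.le hτ.le, ← hev (τ * ξ), abs_mul, abs_of_pos hτ, mul_comm τ]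
    ring
  rw [e2, smul_eq_mul] at e
  have e3 : |ξ| ^ (-γ - 1) = |ξ|⁻¹ * (|ξ| ^ γ)⁻¹ := by
    rw [Real.rpow_sub hp, Real.rpow_neg hp.le, Real.rpow_one]; field_simp
  rw [e3] at e
  have hg : 0 < |ξ| ^ γ := by positivity
  field_simp at e
  linarith

lemma bump_integrable {m : ℝ → ℝ} (hm : Continuous m) (h1 : ∀ s, |s| ≤ 1 → m s = 0)
    (h2 : ∀ s, 2 ≤ |s| → m s = 0) (γ ξ : ℝ) :
    IntegrableOn (fun τ => τ ^ (-γ - 1) * m (τ * ξ)) (Set.Ioi 0) := by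
  by_cases hξ : ξ = 0
  · subst hξ
    simp [h1 0 (by simp)]
  have hp : 0 < |ξ| := abs_pos.2 hξ
  have hsub : IntegrableOn (fun τ => τ ^ (-γ - 1) * m (τ * ξ)) (Set.Icc (1 / |ξ|) (2 / |ξ|)) := by
    refine ContinuousOn.integrableOn_Icc ?_
    refine ContinuousOn.mul ?_ (by fun_prop)
    intro τ hτ
    have : 0 < τ := lt_of_lt_of_le (by positivity) hτ.1
    exact (Real.continuousAt_rpow_const _ _ (Or.inl this.ne')).continuousWithinAt
  refine hsub.of_forall_sdiff_eq_zero measurableSet_Ioi ?_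
  rintro τ ⟨hτ, hn⟩
  have hτ : 0 < τ := hτ
  have : m (τ * ξ) = 0 := by
    by_cases h : 1 / |ξ| ≤ τ
    · apply h2
      rw [abs_mul, abs_of_pos hτ]
      have : ¬ τ ≤ 2 / |ξ| := fun h' => hn ⟨h, h'⟩
      rw [not_le, div_lt_iff₀ hp] at this
      exact this.le
    · apply h1
      rw [abs_mul, abs_of_pos hτ]
      rw [not_le, lt_div_iff₀ hp] at h
      exact h.le
  rw [this, mul_zero]

lemma bump_pos {m : ℝ → ℝ} (hm : Continuous m) (h0 : ∀ s, 0 ≤ m s) (h1 : ∀ s, |s| ≤ 1 → m s = 0)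
    (h2 : ∀ s, 2 ≤ |s| → m s = 0) (h3 : m (3/2) ≠ 0) (γ : ℝ) :
    0 < ∫ s in Set.Ioi 0, s ^ (-γ - 1) * m s := by
  have hi := bump_integrable hm h1 h2 γ 1
  simp only [mul_one] at hi
  rw [setIntegral_pos_iff_support_of_nonneg_ae ?_ hi]
  · have ho : IsOpen ({s | m s ≠ 0} ∩ Set.Ioi 0) :=
      (isOpen_ne_fun hm continuous_const).inter isOpen_Ioi
    refine (ho.measure_pos volume ⟨3/2, h3, by norm_num [Set.mem_Ioi]⟩).trans_le (measure_mono ?_)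
    rintro s ⟨hs, hs0⟩
    have hs0' : 0 < s := hs0
    exact ⟨mul_ne_zero (by positivity) hs, hs0⟩
  · filter_upwards [ae_restrict_mem measurableSet_Ioi] with s hs
    exact mul_nonneg (Real.rpow_nonneg (le_of_lt hs) _) (h0 s)

lemma pointwise_interp {β θ : ℝ} (hβ : 0 < β) (hθ0 : 0 < θ) (hθ1 : θ < 1) :
    ∃ C : ℝ, 0 < C ∧ ∀ h : ℝ → ℂ, Integrable h →
      Integrable (fun ξ => ((|ξ| ^ β : ℝ) : ℂ) * h ξ) →
      Integrable (fun ξ => ((|ξ| ^ (θ * β) : ℝ) : ℂ) * h ξ) → ∀ x,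
      ‖Eh (fun ξ => ((|ξ| ^ (θ * β) : ℝ) : ℂ) * h ξ) x‖ₑ ≤ ENNReal.ofReal C *
        (HLM (fun y => ENNReal.ofReal ‖Eh (fun ξ => ((|ξ| ^ β : ℝ) : ℂ) * h ξ) y‖) x ^ θ *
         HLM (fun y => ENNReal.ofReal ‖Eh h y‖) x ^ (1 - θ)) := by
  obtain ⟨m, hm, h0, hev, h1, h2, h3⟩ := exists_bump
  have hθ' : 0 < 1 - θ := by linarith
  have hγ : 0 < θ * β := by positivity
  set c := ∫ s in Set.Ioi 0, s ^ (-(θ * β) - 1) * m s with hc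
  have hcpos : 0 < c := bump_pos hm.continuous h0 h1 h2 h3 _
  obtain ⟨C1, hC1, hk1⟩ := kernel_bound _ (bump_smooth hm h1 0) (bump_compact h2 0)
  obtain ⟨C2, hC2, hk2⟩ := kernel_bound _ (bump_smooth hm h1 β) (bump_compact h2 β)
  simp only [neg_zero, Real.rpow_zero, mul_one] at hk1
  refine ⟨c⁻¹ * ((1 / ((1 - θ) * β) + 1 / (θ * β)) * (C1 ^ (1 - θ) * C2 ^ θ)), by positivity, ?_⟩
  intro h hh hhβ hhθ x
  set M0 := HLM (fun y => ENNReal.ofReal ‖Eh h y‖) x with hM0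
  set M1 := HLM (fun y => ENNReal.ofReal ‖Eh (fun ξ => ((|ξ| ^ β : ℝ) : ℂ) * h ξ) y‖) x with hM1
  have hM0f : M0 ≠ ∞ := ne_top_of_le_ne_top ENNReal.ofReal_ne_top
    (HLM_le_const (fun y => ENNReal.ofReal_le_ofReal (Eh_bound _ y)) x)
  have hM1f : M1 ≠ ∞ := ne_top_of_le_ne_top ENNReal.ofReal_ne_top
    (HLM_le_const (fun y => ENNReal.ofReal_le_ofReal (Eh_bound _ y)) x)
  set W : ℝ → ℂ := fun τ => Eh (fun ξ => ((m (τ * ξ) : ℝ) : ℂ) * h ξ) x with hW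
  have hW1 : ∀ τ, 0 < τ → ‖W τ‖ₑ ≤ ENNReal.ofReal C1 * M0 := fun τ hτ => hk1 τ hτ h hh x
  have hW2 : ∀ τ, 0 < τ → ‖W τ‖ₑ ≤ ENNReal.ofReal (τ ^ β) * (ENNReal.ofReal C2 * M1) := by
    intro τ hτ
    have hτβ : 0 < τ ^ β := by positivity
    have e : W τ = ((τ ^ β : ℝ) : ℂ) * Eh (fun ξ => ((m (τ * ξ) * |τ * ξ| ^ (-β) : ℝ) : ℂ) *
        (((|ξ| ^ β : ℝ) : ℂ) * h ξ)) x := by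
      simp only [hW, Eh]
      rw [← integral_const_mul]
      refine integral_congr_ae (Eventually.of_forall fun ξ => ?_)
      simp only
      have : m (τ * ξ) = τ ^ β * (m (τ * ξ) * |τ * ξ| ^ (-β)) * |ξ| ^ β := by
        by_cases hξ : ξ = 0
        · subst hξ
          simp [h1 0 (by simp)]
        have hp : 0 < |ξ| := abs_pos.2 hξ
        rw [abs_mul, abs_of_pos hτ, Real.mul_rpow hτ.le hp.le, Real.rpow_neg hτ.le,
          Real.rpow_neg hp.le]
        field_simp
      conv_lhs => rw [this]
      push_cast
      ring
    rw [e, enorm_mul]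
    have e4 : ‖((τ ^ β : ℝ) : ℂ)‖ₑ = ENNReal.ofReal (τ ^ β) := by
      rw [← ofReal_norm, Complex.norm_real, Real.norm_of_nonneg hτβ.le]
    rw [e4]
    exact mul_le_mul_right (hk2 τ hτ _ hhβ x) _
  have hfub : (c : ℂ) * Eh (fun ξ => ((|ξ| ^ (θ * β) : ℝ) : ℂ) * h ξ) x =
      ∫ τ in Set.Ioi 0, ((τ ^ (-(θ * β) - 1) : ℝ) : ℂ) * W τ := by
    have hprodI : Integrable (Function.uncurry fun (ξ τ : ℝ) =>
        ((τ ^ (-(θ * β) - 1) * m (τ * ξ) : ℝ) : ℂ) *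
          (Complex.exp (Complex.I * ((x * ξ : ℝ) : ℂ)) * h ξ))
        (volume.prod (volume.restrict (Set.Ioi 0))) := by
      have hmeas : AEStronglyMeasurable (Function.uncurry fun (ξ τ : ℝ) =>
        ((τ ^ (-(θ * β) - 1) * m (τ * ξ) : ℝ) : ℂ) *
          (Complex.exp (Complex.I * ((x * ξ : ℝ) : ℂ)) * h ξ))
        (volume.prod (volume.restrict (Set.Ioi 0))) := by
        refine AEStronglyMeasurable.mul ?_ (AEStronglyMeasurable.mul ?_ ?_)
        · apply Measurable.aestronglyMeasurable
          have := hm.continuous.measurable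
          fun_prop
        · apply Continuous.aestronglyMeasurable
          fun_prop
        · exact hh.1.comp_fst
      rw [integrable_prod_iff hmeas]
      constructor
      · refine Eventually.of_forall fun ξ => ?_
        have e7 := (bump_integrable hm.continuous h1 h2 (θ * β) ξ).ofReal (𝕜 := ℂ)
        simp only [Function.uncurry]
        exact Integrable.mul_const e7 (Complex.exp (Complex.I * ((x * ξ : ℝ) : ℂ)) * h ξ)
      · refine (hhθ.norm.const_mul c).congr (Eventually.of_forall fun ξ => ?_)
        simp only [Function.uncurry]
        have e5 : ∀ τ ∈ Set.Ioi (0:ℝ), ‖((τ ^ (-(θ * β) - 1) * m (τ * ξ) : ℝ) : ℂ) *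
          (Complex.exp (Complex.I * ((x * ξ : ℝ) : ℂ)) * h ξ)‖ =
            (τ ^ (-(θ * β) - 1) * m (τ * ξ)) * ‖h ξ‖ := by
          intro τ hτ
          rw [norm_mul, norm_mul, norm_exp_I, one_mul, Complex.norm_real, Real.norm_of_nonneg]
          exact mul_nonneg (Real.rpow_nonneg (le_of_lt hτ) _) (h0 _)
        rw [setIntegral_congr_fun measurableSet_Ioi e5, integral_mul_const,
          bump_integral hev h1 hγ, norm_mul, Complex.norm_real, Real.norm_of_nonneg (by positivity)]
        ring
    calc (c : ℂ) * Eh (fun ξ => ((|ξ| ^ (θ * β) : ℝ) : ℂ) * h ξ) x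
        = ∫ ξ, ∫ τ in Set.Ioi 0, ((τ ^ (-(θ * β) - 1) * m (τ * ξ) : ℝ) : ℂ) *
          (Complex.exp (Complex.I * ((x * ξ : ℝ) : ℂ)) * h ξ) := by
          simp only [Eh]
          rw [← integral_const_mul]
          refine integral_congr_ae (Eventually.of_forall fun ξ => ?_)
          simp only
          rw [integral_mul_const, integral_complex_ofReal, bump_integral hev h1 hγ]
          push_cast
          ring
      _ = ∫ τ in Set.Ioi 0, ∫ ξ, ((τ ^ (-(θ * β) - 1) * m (τ * ξ) : ℝ) : ℂ) *
          (Complex.exp (Complex.I * ((x * ξ : ℝ) : ℂ)) * h ξ) := integral_integral_swap hprodI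
      _ = _ := by
          refine integral_congr_ae (Eventually.of_forall fun τ => ?_)
          simp only [hW, Eh]
          rw [← integral_const_mul]
          refine integral_congr_ae (Eventually.of_forall fun ξ => ?_)
          simp only
          push_cast
          ring
  have hmain : ENNReal.ofReal c * ‖Eh (fun ξ => ((|ξ| ^ (θ * β) : ℝ) : ℂ) * h ξ) x‖ₑ ≤
      ENNReal.ofReal (1 / ((1 - θ) * β) + 1 / (θ * β)) *
        ((ENNReal.ofReal C1 * M0) ^ (1 - θ) * (ENNReal.ofReal C2 * M1) ^ θ) := by
    have e6 : ENNReal.ofReal c * ‖Eh (fun ξ => ((|ξ| ^ (θ * β) : ℝ) : ℂ) * h ξ) x‖ₑ =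
        ‖(c : ℂ) * Eh (fun ξ => ((|ξ| ^ (θ * β) : ℝ) : ℂ) * h ξ) x‖ₑ := by
      rw [enorm_mul]; congr 1
      rw [← ofReal_norm, Complex.norm_real, Real.norm_of_nonneg hcpos.le]
    rw [e6, hfub]
    refine (enorm_integral_le_lintegral_enorm _).trans ?_
    refine le_trans (le_of_eq ?_) (min_integral hβ hθ0 hθ1
      (ENNReal.mul_ne_top ENNReal.ofReal_ne_top hM0f)
      (ENNReal.mul_ne_top ENNReal.ofReal_ne_top hM1f) (W := fun τ => ‖W τ‖ₑ) hW1 hW2)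
    refine setLIntegral_congr_fun measurableSet_Ioi fun τ hτ => ?_
    rw [enorm_mul]; congr 1
    rw [← ofReal_norm, Complex.norm_real, Real.norm_of_nonneg (Real.rpow_nonneg (le_of_lt hτ) _)]
  have hD : 0 < 1 / ((1 - θ) * β) + 1 / (θ * β) := by positivity
  generalize 1 / ((1 - θ) * β) + 1 / (θ * β) = D at *
  calc _ = ENNReal.ofReal c⁻¹ * (ENNReal.ofReal c *
        ‖Eh (fun ξ => ((|ξ| ^ (θ * β) : ℝ) : ℂ) * h ξ) x‖ₑ) := by
        rw [← mul_assoc, ← ENNReal.ofReal_mul (by positivity), inv_mul_cancel₀ hcpos.ne']; simp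
    _ ≤ ENNReal.ofReal c⁻¹ * (ENNReal.ofReal D *
        ((ENNReal.ofReal C1 * M0) ^ (1 - θ) * (ENNReal.ofReal C2 * M1) ^ θ)) := by gcongr
    _ = _ := by
        rw [ENNReal.mul_rpow_of_nonneg _ _ hθ'.le, ENNReal.mul_rpow_of_nonneg _ _ hθ0.le,
          ENNReal.ofReal_mul (by positivity), ENNReal.ofReal_mul (by positivity),
          ENNReal.ofReal_mul (by positivity), ENNReal.ofReal_rpow_of_pos hC1,
          ENNReal.ofReal_rpow_of_pos hC2]
        ring

lemma holder_interp {p₀ p₁ θ : ℝ} (hp₀ : 0 < p₀) (hp₁ : 0 < p₁) (hθ0 : 0 < θ) (hθ1 : θ < 1)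
    {F G H : ℝ → ℝ≥0∞} (hF : Measurable F) (hG : Measurable G) {c : ℝ≥0∞}
    (h : ∀ x, H x ≤ c * (F x ^ θ * G x ^ (1 - θ))) :
    (∫⁻ x, H x ^ (θ / p₁ + (1 - θ) / p₀)⁻¹) ^ (1 / (θ / p₁ + (1 - θ) / p₀)⁻¹) ≤
      c * (((∫⁻ x, F x ^ p₁) ^ (1 / p₁)) ^ θ * ((∫⁻ x, G x ^ p₀) ^ (1 / p₀)) ^ (1 - θ)) := by
  have hθ' : 0 < 1 - θ := by linarith
  set p := (θ / p₁ + (1 - θ) / p₀)⁻¹ with hp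
  have hpp : 0 < p := by positivity
  have hab : p * (θ / p₁) + p * ((1 - θ) / p₀) = 1 := by
    rw [← mul_add, hp]; exact inv_mul_cancel₀ (by positivity)
  have h1 : ∫⁻ x, H x ^ p ≤ c ^ p * ((∫⁻ x, F x ^ p₁) ^ (p * (θ / p₁)) *
      (∫⁻ x, G x ^ p₀) ^ (p * ((1 - θ) / p₀))) := by
    calc ∫⁻ x, H x ^ p ≤ ∫⁻ x, c ^ p * ((F x ^ p₁) ^ (p * (θ / p₁)) *
          (G x ^ p₀) ^ (p * ((1 - θ) / p₀))) := by
          refine lintegral_mono fun x => ?_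
          refine (ENNReal.rpow_le_rpow (h x) hpp.le).trans (le_of_eq ?_)
          rw [ENNReal.mul_rpow_of_nonneg _ _ hpp.le, ENNReal.mul_rpow_of_nonneg _ _ hpp.le,
            ← ENNReal.rpow_mul, ← ENNReal.rpow_mul, ← ENNReal.rpow_mul, ← ENNReal.rpow_mul]
          congr 3
          · field_simp
          · field_simp
      _ = c ^ p * ∫⁻ x, ((F x ^ p₁) ^ (p * (θ / p₁)) * (G x ^ p₀) ^ (p * ((1 - θ) / p₀))) := by
          rw [lintegral_const_mul]
          fun_prop
      _ ≤ _ := by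
          gcongr
          exact ENNReal.lintegral_mul_norm_pow_le (by fun_prop) (by fun_prop) (by positivity)
            (by positivity) hab
  have hp' : 0 ≤ 1 / p := by positivity
  refine (ENNReal.rpow_le_rpow h1 hp').trans (le_of_eq ?_)
  rw [ENNReal.mul_rpow_of_nonneg _ _ hp', ENNReal.mul_rpow_of_nonneg _ _ hp',
    ← ENNReal.rpow_mul, ← ENNReal.rpow_mul, ← ENNReal.rpow_mul, ← ENNReal.rpow_mul,
    ← ENNReal.rpow_mul]
  rw [mul_one_div_cancel hpp.ne', ENNReal.rpow_one]
  congr 3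
  · field_simp
  · field_simp

/-- The operator `|D|^α` applied to the inverse Fourier integral of `g`. -/
def uD (α : ℝ) (g : ℝ → ℂ) : ℝ → ℂ := Eh (fun ξ => ((|ξ| ^ α : ℝ) : ℂ) * g ξ)

/-- The `L^q` norm. -/
def Nq (q : ℝ) (u : ℝ → ℂ) : ℝ≥0∞ := (∫⁻ x, ‖u x‖ₑ ^ q) ^ (1 / q)

lemma uD_integrable {α : ℝ} (hα : 0 < α) {g : ℝ → ℂ} (hg : Continuous g) (hc : HasCompactSupport g) :
    Integrable (fun ξ => ((|ξ| ^ α : ℝ) : ℂ) * g ξ) := by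
  refine Continuous.integrable_of_hasCompactSupport ?_ hc.mul_left
  refine Continuous.mul (Complex.continuous_ofReal.comp ?_) hg
  exact continuous_abs.rpow_const fun _ => Or.inr hα.le

lemma HLM_Nq {q : ℝ} (hq : 1 < q) {h : ℝ → ℂ} (hh : Integrable h) :
    (∫⁻ x, HLM (fun y => ENNReal.ofReal ‖Eh h y‖) x ^ q) ^ (1 / q) ≤
      ENNReal.ofReal ((q * (10 * (2 ^ (q-1) / (q-1)))) ^ (1 / q)) * Nq q (Eh h) := by
  have h1 := HLM_strong hq (Eh_cont hh).norm.measurable (fun x => norm_nonneg _) (Eh_bound h)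
  have hq' : 0 ≤ 1 / q := by positivity
  refine (ENNReal.rpow_le_rpow h1 hq').trans (le_of_eq ?_)
  have : 0 < q - 1 := by linarith
  rw [ENNReal.mul_rpow_of_nonneg _ _ hq', ENNReal.ofReal_rpow_of_nonneg (by positivity) hq']
  simp only [ofReal_norm, Nq]

lemma interp_lt {q₀ q₁ α₀ α₁ θ : ℝ} (hq₀ : 1 < q₀) (hq₁ : 1 < q₁)
    (hα₀ : 0 < α₀) (hα : α₀ < α₁) (hθ0 : 0 < θ) (hθ1 : θ < 1) :
    ∃ C : ℝ, 0 < C ∧ ∀ g : ℝ → ℂ, Continuous g → HasCompactSupport g →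
      Nq (θ / q₁ + (1 - θ) / q₀)⁻¹ (uD (θ * α₁ + (1 - θ) * α₀) g) ≤
        ENNReal.ofReal C * (Nq q₁ (uD α₁ g) ^ θ * Nq q₀ (uD α₀ g) ^ (1 - θ)) := by
  have hθ' : 0 < 1 - θ := by linarith
  have hβ : 0 < α₁ - α₀ := by linarith
  obtain ⟨C, hC, hpt⟩ := pointwise_interp hβ hθ0 hθ1
  set K₀ := (q₀ * (10 * (2 ^ (q₀-1) / (q₀-1)))) ^ (1 / q₀) with hK₀
  set K₁ := (q₁ * (10 * (2 ^ (q₁-1) / (q₁-1)))) ^ (1 / q₁) with hK₁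
  have hK₀p : 0 < K₀ := by have : 0 < q₀ - 1 := by linarith
                           positivity
  have hK₁p : 0 < K₁ := by have : 0 < q₁ - 1 := by linarith
                           positivity
  refine ⟨C * (K₁ ^ θ * K₀ ^ (1 - θ)), by positivity, fun g hg hgc => ?_⟩
  have i0 := uD_integrable hα₀ hg hgc
  have i1 := uD_integrable (hα₀.trans hα) hg hgc
  have iθ := uD_integrable (α := θ * α₁ + (1 - θ) * α₀)
    (by have := hα₀.trans hα; positivity) hg hgc
  have hmul : ∀ a : ℝ, 0 < a → ∀ ξ : ℝ, ((|ξ| ^ a : ℝ) : ℂ) * (((|ξ| ^ α₀ : ℝ) : ℂ) * g ξ) =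
      ((|ξ| ^ (a + α₀) : ℝ) : ℂ) * g ξ := by
    intro a ha ξ
    rw [Real.rpow_add_of_nonneg (abs_nonneg _) ha.le hα₀.le]
    push_cast
    ring
  have eθ : θ * (α₁ - α₀) + α₀ = θ * α₁ + (1 - θ) * α₀ := by ring
  have h1 := hpt _ i0 (by simpa only [hmul _ hβ, sub_add_cancel] using i1)
    (by
      simp only [hmul _ (mul_pos hθ0 hβ), eθ]
      exact iθ)
  simp only [hmul _ hβ, sub_add_cancel, hmul _ (mul_pos hθ0 hβ)] at h1
  rw [eθ] at h1
  have hm0 : Measurable (HLM (fun y => ENNReal.ofReal ‖uD α₀ g y‖)) :=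
    HLM_measurable (Eh_cont i0).norm.measurable.ennreal_ofReal
  have hm1 : Measurable (HLM (fun y => ENNReal.ofReal ‖uD α₁ g y‖)) :=
    HLM_measurable (Eh_cont i1).norm.measurable.ennreal_ofReal
  have h2 := holder_interp (p₀ := q₀) (p₁ := q₁) (by linarith) (by linarith) hθ0 hθ1 hm1 hm0 h1
  refine h2.trans ?_
  rw [ENNReal.ofReal_mul hC.le, mul_assoc]
  refine mul_le_mul_right ?_ _
  calc _ ≤ (ENNReal.ofReal K₁ * Nq q₁ (uD α₁ g)) ^ θ *
        (ENNReal.ofReal K₀ * Nq q₀ (uD α₀ g)) ^ (1 - θ) := by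
        gcongr
        · exact HLM_Nq hq₁ i1
        · exact HLM_Nq hq₀ i0
    _ = _ := by
        rw [ENNReal.mul_rpow_of_nonneg _ _ hθ'.le, ENNReal.mul_rpow_of_nonneg _ _ hθ0.le,
          ENNReal.ofReal_mul (by positivity), ENNReal.ofReal_rpow_of_pos hK₁p,
          ENNReal.ofReal_rpow_of_pos hK₀p]
        ring

lemma interp_all {q₀ q₁ α₀ α₁ θ : ℝ} (hq₀ : 1 < q₀) (hq₁ : 1 < q₁)
    (hα₀ : 0 < α₀) (hα₁ : 0 < α₁) (hθ0 : 0 < θ) (hθ1 : θ < 1) :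
    ∃ C : ℝ, 0 < C ∧ ∀ g : ℝ → ℂ, Continuous g → HasCompactSupport g →
      Nq (θ / q₁ + (1 - θ) / q₀)⁻¹ (uD (θ * α₁ + (1 - θ) * α₀) g) ≤
        ENNReal.ofReal C * (Nq q₁ (uD α₁ g) ^ θ * Nq q₀ (uD α₀ g) ^ (1 - θ)) := by
  rcases lt_trichotomy α₀ α₁ with h | h | h
  · exact interp_lt hq₀ hq₁ hα₀ h hθ0 hθ1
  · subst h
    refine ⟨1, one_pos, fun g hg hgc => ?_⟩
    have hm : Measurable (fun x => ‖uD α₀ g x‖ₑ) :=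
      (Eh_cont (uD_integrable hα₀ hg hgc)).measurable.enorm
    rw [show θ * α₀ + (1 - θ) * α₀ = α₀ by ring]
    refine holder_interp (by linarith) (by linarith) hθ0 hθ1 hm hm ?_
    intro x
    rw [← ENNReal.rpow_add_of_nonneg _ _ hθ0.le (by linarith)]
    simp
  · obtain ⟨C, hC, hb⟩ := interp_lt (θ := 1 - θ) hq₁ hq₀ hα₁ h (by linarith) (by linarith)
    refine ⟨C, hC, fun g hg hgc => ?_⟩
    have := hb g hg hgc
    rw [sub_sub_cancel] at this
    rw [add_comm (θ / q₁), add_comm (θ * α₁), mul_comm (Nq q₁ _ ^ θ)]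
    exact this

lemma uD_joint_measurable {α : ℝ} (hα : 0 < α) {g : ℝ → ℝ → ℂ}
    (hgj : Continuous (fun z : ℝ × ℝ => g z.1 z.2)) :
    Measurable (fun z : ℝ × ℝ => uD α (g z.1) z.2) := by
  apply StronglyMeasurable.measurable
  have hgj' : Continuous (fun w : (ℝ × ℝ) × ℝ => g w.1.1 w.2) := by
    have h : Continuous (fun w : (ℝ × ℝ) × ℝ => (w.1.1, w.2)) := by fun_prop
    exact hgj.comp h
  have hab : Continuous (fun w : (ℝ × ℝ) × ℝ => ((|w.2| ^ α : ℝ) : ℂ)) :=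
    Complex.continuous_ofReal.comp
      ((continuous_abs.comp continuous_snd).rpow_const fun _ => Or.inr hα.le)
  have hex : Continuous (fun w : (ℝ × ℝ) × ℝ =>
      Complex.exp (Complex.I * ((w.1.2 * w.2 : ℝ) : ℂ))) := by fun_prop
  exact StronglyMeasurable.integral_prod_right' (f := fun w : (ℝ × ℝ) × ℝ =>
    Complex.exp (Complex.I * ((w.1.2 * w.2 : ℝ) : ℂ)) * (((|w.2| ^ α : ℝ) : ℂ) * g w.1.1 w.2))
    (hex.mul (hab.mul hgj')).stronglyMeasurable

/-- complex interpolation for mixed-norm estimates of fractional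
derivatives. -/
theorem complex_interpolation_mixed (p₀ p₁ q₀ q₁ α₀ α₁ θ : ℝ)
    (hp₀ : 1 < p₀) (hp₁ : 1 < p₁) (hq₀ : 1 < q₀) (hq₁ : 1 < q₁)
    (hα₀ : 0 < α₀) (hα₁ : 0 < α₁) (hθ : θ ∈ Set.Ioo (0:ℝ) 1) :
    ∃ C : ℝ, 0 < C ∧
      ∀ f : ℝ → ℝ → ℂ,
        ContDiff ℝ (⊤ : ℕ∞) (fun z : ℝ × ℝ => ft (f z.1) z.2) →
        HasCompactSupport (fun z : ℝ × ℝ => ft (f z.1) z.2) →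
        (∀ z : ℝ × ℝ, z ∈ tsupport (fun z : ℝ × ℝ => ft (f z.1) z.2) → z.2 ≠ 0) →
        mixedNorm (θ / p₁ + (1 - θ) / p₀)⁻¹ (θ / q₁ + (1 - θ) / q₀)⁻¹
            (fracDx (θ * α₁ + (1 - θ) * α₀) f) ≤
          ENNReal.ofReal C *
            mixedNorm p₁ q₁ (fracDx α₁ f) ^ θ *
            mixedNorm p₀ q₀ (fracDx α₀ f) ^ (1 - θ) := by
  obtain ⟨hθ0, hθ1⟩ := hθ
  obtain ⟨C, hC, hb⟩ := interp_all hq₀ hq₁ hα₀ hα₁ hθ0 hθ1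
  refine ⟨C, hC, fun f hf hfc _ => ?_⟩
  set cc : ℂ := ((Real.sqrt (2 * Real.pi) : ℝ) : ℂ)⁻¹ with hcc
  set g : ℝ → ℝ → ℂ := fun t ξ => cc * ft (f t) ξ with hg
  have hfr : ∀ α t, fracDx α f t = uD α (g t) := by
    intro α t
    ext x
    simp only [fracDx, uD, Eh, hg]
    rw [← integral_const_mul]
    refine integral_congr_ae (Eventually.of_forall fun ξ => ?_)
    simp only
    ring
  have hgj : Continuous (fun z : ℝ × ℝ => g z.1 z.2) := continuous_const.mul hf.continuous
  have hgcont : ∀ t, Continuous (g t) := fun t =>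
    hgj.comp (Continuous.prodMk continuous_const continuous_id)
  have hgc : ∀ t, HasCompactSupport (g t) := by
    intro t
    refine HasCompactSupport.intro (hfc.isCompact.image continuous_snd) fun ξ hξ => ?_
    have : (t, ξ) ∉ tsupport (fun z : ℝ × ℝ => ft (f z.1) z.2) := fun h => hξ ⟨_, h, rfl⟩
    have := image_eq_zero_of_notMem_tsupport this
    simp only at this
    simp only [hg, this, mul_zero]
  have hjm : ∀ α, 0 < α → Measurable (fun z : ℝ × ℝ => uD α (g z.1) z.2) :=
    fun α hα => uD_joint_measurable hα hgj
  have hNm : ∀ α q, 0 < α → Measurable (fun t => Nq q (uD α (g t))) := by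
    intro α q hα
    simp only [Nq]
    refine Measurable.pow_const ?_ _
    exact Measurable.lintegral_prod_right' (f := fun z : ℝ × ℝ => ‖uD α (g z.1) z.2‖ₑ ^ q)
      ((hjm α hα).enorm.pow_const _)
  have hmix : ∀ p q α, mixedNorm p q (fracDx α f) = (∫⁻ t, Nq q (uD α (g t)) ^ p) ^ (1 / p) := by
    intro p q α
    simp only [mixedNorm, hfr, Nq]
    congr 1
    refine lintegral_congr fun t => ?_
    rw [← ENNReal.rpow_mul, one_div_mul_eq_div]
    rfl
  rw [hmix, hmix, hmix, mul_assoc]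
  exact holder_interp (by linarith) (by linarith) hθ0 hθ1 (hNm _ _ hα₁) (hNm _ _ hα₀)
    fun t => hb (g t) (hgcont t) (hgc t)

end
end
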